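/- arXiv:2101.01318 — 4 statements merged into one kernel-verified Lean document; each statement's English description precedes it below -/
import Mathlib

section
/- Let N and v be integers with 2 ≤ v ≤ N+1. Then the largest integer k for which there exists a (1,1)-locating array with N rows, k columns and v symbols (i.e., an N×k array on v symbols whose kv fibers are pairwise distinct) equals Λ(N,v); equivalently, such an array with k columns exists if and only if 0 ≤ k ≤ Λ(N,v). -/
/-- `Λ(N,v)` from the paper: with `f = ⌊(N+1)/v⌋` and `d = (f+1)v − N`,
`Λ(N,v) = ⌊(1/d)·Σ_{i=f−d+2}^{f} (f+1−i)·C(N,i)⌋ + Σ_{i=0}^{f−d+1} C(N,i)`,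
where terms with negative index `i` vanish (here realized by the truncated
subtraction `f + 2 - d = max (f - d + 2) 0`, which is correct because
`C(N,i) = 0` for `i < 0`). -/
def Lam (N v : ℕ) : ℕ :=
  let f := (N + 1) / v
  let d := (f + 1) * v - N
  (∑ i ∈ Finset.Icc (f + 2 - d) f, (f + 1 - i) * N.choose i) / d
    + ∑ i ∈ Finset.range (f + 2 - d), N.choose i

namespace LocArr
open Finset

theorem rounding {C K : Type} [Fintype C] [DecidableEq C] [Fintype K] [DecidableEq K]
    (x : C → K → ℕ) (n : ℕ) (hn : 0 < n) (l u : K → ℕ)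
    (hx : ∀ c, ∑ κ, x c κ = n)
    (hl : ∀ κ, n * l κ ≤ ∑ c, x c κ) (hu : ∀ κ, ∑ c, x c κ ≤ n * u κ) :
    ∃ g : C → K, (∀ c, 0 < x c (g c)) ∧
      ∀ κ, l κ ≤ #{c | g c = κ} ∧ #{c | g c = κ} ≤ u κ := by
  classical
  have hlu : ∀ κ, l κ ≤ u κ := fun κ => Nat.le_of_mul_le_mul_left ((hl κ).trans (hu κ)) hn
  have hku : Fintype.card C ≤ ∑ κ, u κ := by
    refine Nat.le_of_mul_le_mul_left ?_ hn
    calc n * Fintype.card C = ∑ c : C, ∑ κ, x c κ := by simp [hx, mul_comm]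
      _ = ∑ κ, ∑ c, x c κ := sum_comm
      _ ≤ ∑ κ, n * u κ := sum_le_sum fun κ _ => hu κ
      _ = n * ∑ κ, u κ := by rw [mul_sum]
  set D := (∑ κ, u κ) - Fintype.card C with hD
  let t : C ⊕ Fin D → Finset (Σ κ, Fin (u κ)) := fun a => match a with
    | Sum.inl c => univ.filter fun s => 0 < x c s.1
    | Sum.inr _ => univ.filter fun s => l s.1 ≤ s.2.1
  have hcardopt : ∀ κ, #(univ.filter fun j : Fin (u κ) => l κ ≤ j.1) = u κ - l κ := by
    intro κ
    have h1 := Fin.card_filter_val_lt (n := u κ) (m := l κ)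
    have h2 := card_filter_add_card_filter_not (s := (univ : Finset (Fin (u κ)))) (fun j => j.1 < l κ)
    simp only [not_lt, card_univ, Fintype.card_fin] at h2
    have := hlu κ
    rw [h1, min_eq_right this] at h2
    omega
  have hall : ∀ s : Finset (C ⊕ Fin D), #s ≤ #(s.biUnion t) := by
    intro s
    set S := s.toLeft with hS
    set J : Finset K := univ.filter fun κ => ∃ c ∈ S, 0 < x c κ with hJ
    have hs : #s = #S + #s.toRight := (card_toLeft_add_card_toRight).symm
    have hdd : #s.toRight ≤ D := by simpa using card_le_univ s.toRight
    by_cases hr : s.toRight = ∅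
    · rw [hs, hr, card_empty, add_zero]
      have hsub : J.sigma (fun κ => (univ : Finset (Fin (u κ)))) ⊆ s.biUnion t := by
        intro ⟨κ, j⟩ h
        simp only [mem_sigma, mem_univ, and_true, hJ, mem_filter, true_and] at h
        obtain ⟨c, hc, hp⟩ := h
        rw [mem_biUnion]
        exact ⟨Sum.inl c, by simpa [hS] using hc, by simp [t, hp]⟩
      refine le_trans ?_ (card_le_card hsub)
      rw [card_sigma]
      simp only [card_univ, Fintype.card_fin]
      refine Nat.le_of_mul_le_mul_left ?_ hn
      calc n * #S = ∑ c ∈ S, ∑ κ, x c κ := by simp [hx, mul_comm]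
        _ = ∑ c ∈ S, ∑ κ ∈ J, x c κ := by
            refine sum_congr rfl fun c hc => ?_
            symm
            refine sum_subset (subset_univ _) fun κ _ hκ => ?_
            by_contra h0
            exact hκ (by simp only [hJ, mem_filter, mem_univ, true_and]; exact ⟨c, hc, Nat.pos_of_ne_zero h0⟩)
        _ = ∑ κ ∈ J, ∑ c ∈ S, x c κ := sum_comm
        _ ≤ ∑ κ ∈ J, ∑ c, x c κ := sum_le_sum fun κ _ => sum_le_sum_of_subset (subset_univ _)
        _ ≤ ∑ κ ∈ J, n * u κ := sum_le_sum fun κ _ => hu κ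
        _ = n * ∑ κ ∈ J, u κ := by rw [mul_sum]
    · obtain ⟨e, he⟩ := nonempty_iff_ne_empty.2 hr
      have hsub : (univ : Finset K).sigma (fun κ => (univ : Finset (Fin (u κ))).filter
          fun j => κ ∈ J ∨ l κ ≤ j.1) ⊆ s.biUnion t := by
        intro ⟨κ, j⟩ h
        simp only [mem_sigma, mem_univ, true_and, mem_filter] at h
        rw [mem_biUnion]
        rcases h with h | h
        · simp only [hJ, mem_filter, mem_univ, true_and] at h
          obtain ⟨c, hc, hp⟩ := h
          exact ⟨Sum.inl c, by simpa [hS] using hc, by simp [t, hp]⟩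
        · exact ⟨Sum.inr e, by simpa using he, by simp [t, h]⟩
      refine le_trans ?_ (card_le_card hsub)
      rw [card_sigma]
      have hc1 : ∀ κ, #((univ : Finset (Fin (u κ))).filter fun j => κ ∈ J ∨ l κ ≤ j.1)
          + (if κ ∈ J then 0 else l κ) = u κ := by
        intro κ
        by_cases hk : κ ∈ J
        · simp [hk]
        · simp only [hk, false_or, if_false, hcardopt]
          have := hlu κ
          omega
      have hc2 : (∑ κ, #((univ : Finset (Fin (u κ))).filter fun j => κ ∈ J ∨ l κ ≤ j.1))
          + ∑ κ, (if κ ∈ J then 0 else l κ) = ∑ κ, u κ := by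
        rw [← sum_add_distrib]; exact sum_congr rfl fun κ _ => hc1 κ
      have hc3 : (∑ κ, (if κ ∈ J then 0 else l κ)) + #S ≤ Fintype.card C := by
        rw [← card_univ (α := C), ← card_sdiff_add_card_eq_card (subset_univ S)]
        refine Nat.add_le_add_right (Nat.le_of_mul_le_mul_left ?_ hn) _
        calc n * ∑ κ, (if κ ∈ J then 0 else l κ) = ∑ κ, n * (if κ ∈ J then 0 else l κ) := by rw [mul_sum]
          _ ≤ ∑ κ, ∑ c ∈ univ \ S, x c κ := by
              refine sum_le_sum fun κ _ => ?_
              split_ifs with hk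
              · simp
              · refine (hl κ).trans (le_of_eq ?_)
                symm
                refine sum_subset (subset_univ _) fun c _ hc => ?_
                have hc : c ∈ S := by simpa using hc
                by_contra h0
                exact hk (by simp only [hJ, mem_filter, mem_univ, true_and]; exact ⟨c, hc, Nat.pos_of_ne_zero h0⟩)
          _ = ∑ c ∈ univ \ S, ∑ κ, x c κ := sum_comm
          _ = n * #(univ \ S) := by simp [hx, mul_comm]
      omega
  obtain ⟨F, hF, hFt⟩ := (Finset.all_card_le_biUnion_card_iff_exists_injective t).1 hall
  have hbij : Function.Bijective F := by
    rw [Fintype.bijective_iff_injective_and_card]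
    refine ⟨hF, ?_⟩
    simp; omega
  refine ⟨fun c => (F (Sum.inl c)).1, fun c => ?_, fun κ => ⟨?_, ?_⟩⟩
  · have := hFt (Sum.inl c)
    simpa [t] using this
  · have hex : ∀ j : Fin (l κ), ∃ c, F (Sum.inl c) = ⟨κ, ⟨j.1, j.2.trans_le (hlu κ)⟩⟩ := by
      intro j
      obtain ⟨a, ha⟩ := hbij.2 ⟨κ, ⟨j.1, j.2.trans_le (hlu κ)⟩⟩
      rcases a with c | e
      · exact ⟨c, ha⟩
      · have := hFt (Sum.inr e)
        rw [ha] at this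
        simp [t] at this
        omega
    choose G hG using hex
    have := card_le_card_of_injOn (s := (univ : Finset (Fin (l κ)))) (t := ({c | (F (Sum.inl c)).1 = κ} : Finset C)) G
      (by intro j _; simp [hG]) (by
        intro a _ b _ hab
        have h := hG a
        rw [hab, hG b] at h
        simp at h
        exact Fin.ext h.symm)
    simpa using this
  · have : #({c | (F (Sum.inl c)).1 = κ} : Finset C) ≤ #(({κ} : Finset K).sigma fun κ => (univ : Finset (Fin (u κ)))) := by
      refine card_le_card_of_injOn (fun c => F (Sum.inl c)) ?_ ?_
      · intro c hc
        simp at hc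
        simp [hc]
      · intro a _ b _ hab
        exact Sum.inl_injective (hF hab)
    simpa using this

theorem baranyai {C : Type} [Fintype C] [DecidableEq C] (v : ℕ) (n : ℕ) :
    ∀ (α : Type) [Fintype α] [DecidableEq α] (L : C → Fin v → α) (m : C → Fin v → ℕ)
      (_ : ∀ c, ∑ σ, m c σ = n)
      (_ : ∀ a i, #{p : C × Fin v | L p.1 p.2 = a ∧ m p.1 p.2 = i} ≤ n.choose i),
      ∃ A : Fin n → C → Fin v, Function.Injective
        fun p : C × Fin v => (L p.1 p.2, {r : Fin n | A r p.1 = p.2}) := by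
  induction n with
  | zero =>
    intro α _ _ L m hm hc
    refine ⟨fun r => r.elim0, ?_⟩
    intro p q hpq
    simp only [Prod.mk.injEq] at hpq
    have h0 : ∀ p : C × Fin v, m p.1 p.2 = 0 := by
      intro p
      have := hm p.1
      rw [sum_eq_zero_iff] at this
      exact this p.2 (mem_univ _)
    have := hc (L q.1 q.2) 0
    rw [Nat.choose_self, card_le_one] at this
    exact this p (by simp [h0, hpq.1]) q (by simp [h0])
  | succ n ih =>
    intro α _ _ L m hm hc
    have hmle : ∀ c σ, m c σ < n + 2 := by
      intro c σ
      have := single_le_sum (f := m c) (fun _ _ => Nat.zero_le _) (mem_univ σ)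
      rw [hm] at this; omega
    let cls : C → Fin v → α × Fin (n + 2) := fun c σ => (L c σ, ⟨m c σ, hmle c σ⟩)
    let cnt : α × Fin (n + 2) → ℕ := fun κ => #{p : C × Fin v | cls p.1 p.2 = κ}
    have hcnt : ∀ κ, cnt κ ≤ (n + 1).choose κ.2.1 := by
      intro κ
      refine le_trans (card_le_card ?_) (hc κ.1 κ.2.1)
      intro p hp
      simp only [mem_filter, mem_univ, true_and, cls] at hp ⊢
      rw [← hp]; simp
    have hsum : ∀ κ : α × Fin (n + 2), ∑ c, ∑ σ, (if cls c σ = κ then m c σ else 0) = κ.2.1 * cnt κ := by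
      intro κ
      rw [← Fintype.sum_prod_type' (fun c σ => if cls c σ = κ then m c σ else 0)]
      rw [← sum_filter]
      rw [sum_congr rfl (g := fun _ => κ.2.1)]
      · simp [cnt, mul_comm]
      · intro p hp
        simp only [mem_filter, mem_univ, true_and, cls] at hp
        rw [← hp]
    obtain ⟨g, hg1, hg2⟩ := rounding (fun c κ => ∑ σ, if cls c σ = κ then m c σ else 0) (n + 1)
      (Nat.succ_pos _) (fun κ => cnt κ - n.choose κ.2.1)
      (fun κ => if κ.2.1 = 0 then 0 else n.choose (κ.2.1 - 1))
      (by
        intro c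
        rw [sum_comm]
        simp [hm])
      (by
        intro κ
        rw [hsum]
        have h1 := hcnt κ
        have h2 := Nat.choose_mul_succ_eq n κ.2.1
        have h3 : κ.2.1 ≤ n + 1 := Nat.lt_succ_iff.1 κ.2.2
        rcases Nat.le_total (cnt κ) (n.choose κ.2.1) with h | h
        · simp [Nat.sub_eq_zero_of_le h]
        · have h3' : (κ.2.1 : ℤ) ≤ n + 1 := by exact_mod_cast h3
          zify [h, h3] at h1 h2 ⊢
          have : ((n:ℤ) + 1 - κ.2.1) * cnt κ ≤ ((n:ℤ) + 1 - κ.2.1) * ((n+1).choose κ.2.1) :=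
            mul_le_mul_of_nonneg_left h1 (by linarith)
          nlinarith)
      (by
        intro κ
        rw [hsum]
        split_ifs with h
        · simp [h]
        · obtain ⟨i, hi⟩ := Nat.exists_eq_succ_of_ne_zero h
          have h1 := hcnt κ
          rw [hi] at h1 ⊢
          have h2 := Nat.add_one_mul_choose_eq n i
          simp only [Nat.succ_eq_add_one, Nat.add_sub_cancel] at *
          rw [h2, mul_comm]
          exact Nat.mul_le_mul_right _ h1)
    have hs : ∀ c, ∃ σ, cls c σ = g c ∧ 0 < m c σ := by
      intro c
      have := hg1 c
      by_contra hcon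
      push Not at hcon
      rw [sum_eq_zero] at this
      · exact lt_irrefl _ this
      · intro σ _
        split_ifs with h
        · exact Nat.le_zero.1 (hcon σ h)
        · rfl
    choose s hs1 hs2 using hs
    have hh : ∀ κ, #{c | g c = κ} = #{p : C × Fin v | cls p.1 p.2 = κ ∧ s p.1 = p.2} := by
      intro κ
      refine card_bij (fun c _ => (c, s c)) ?_ ?_ ?_
      · intro c hc; simp at hc ⊢; rw [hs1, hc]
      · intro a _ b _ h; exact (Prod.mk.inj h).1
      · rintro ⟨c, σ⟩ h
        simp at h
        refine ⟨c, ?_, by simp [h.2]⟩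
        simp [← hs1, h.2, h.1]
    obtain ⟨A, hA⟩ := ih (α × Bool) (fun c σ => (L c σ, decide (s c = σ)))
      (fun c σ => if s c = σ then m c σ - 1 else m c σ)
      (by
        intro c
        have h1 := hm c
        rw [← add_sum_erase univ _ (mem_univ (s c))] at h1 ⊢
        simp only [if_true]
        rw [sum_congr rfl (g := fun σ => m c σ)]
        · have := hs2 c; omega
        · intro σ hσ
          simp at hσ
          simp [Ne.symm hσ])
      (by
        rintro ⟨a, b⟩ i
        cases b with
        | true =>
          by_cases hi : i + 1 < n + 2
          · have h2 := (hg2 (a, ⟨i + 1, hi⟩)).2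
            rw [hh] at h2
            simp only [Nat.add_sub_cancel, Nat.succ_ne_zero, if_false] at h2
            refine le_trans (card_le_card ?_) h2
            rintro ⟨c, σ⟩ hp
            simp at hp
            obtain ⟨⟨h3, h4⟩, h5⟩ := hp
            have := hs2 c
            simp [cls, h3, h4] at h5 ⊢
            subst h4
            omega
          · rw [card_eq_zero.2]
            · exact Nat.zero_le _
            · rw [filter_eq_empty_iff]
              rintro ⟨c, σ⟩ _ hp
              simp at hp
              obtain ⟨⟨h3, h4⟩, h5⟩ := hp
              simp [h4] at h5
              have := hmle c σ
              have := hs2 c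
              subst h4
              omega
        | false =>
          by_cases hi : i < n + 2
          · have h2 := (hg2 (a, ⟨i, hi⟩)).1
            rw [hh] at h2
            have h6 := card_filter_add_card_filter_not
              (s := ({p : C × Fin v | cls p.1 p.2 = (a, ⟨i, hi⟩)} : Finset _)) (fun p => s p.1 = p.2)
            rw [filter_filter, filter_filter] at h6
            have h7 : #{p : C × Fin v | ((L p.1 p.2, decide (s p.1 = p.2)) = (a, false)) ∧ (if s p.1 = p.2 then m p.1 p.2 - 1 else m p.1 p.2) = i} ≤ #{p : C × Fin v | cls p.1 p.2 = (a, ⟨i, hi⟩) ∧ ¬ s p.1 = p.2} := by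
              refine card_le_card ?_
              rintro ⟨c, σ⟩ hp
              simp at hp
              obtain ⟨⟨h3, h4⟩, h5⟩ := hp
              simp [h4] at h5
              simp [cls, h3, h4, h5]
            simp only [cnt] at h2
            omega
          · rw [card_eq_zero.2]
            · exact Nat.zero_le _
            · rw [filter_eq_empty_iff]
              rintro ⟨c, σ⟩ _ hp
              simp at hp
              obtain ⟨⟨h3, h4⟩, h5⟩ := hp
              simp [h4] at h5
              have := hmle c σ
              omega)
    refine ⟨Fin.cons s A, ?_⟩
    intro p q hpq
    simp only [Prod.mk.injEq] at hpq
    obtain ⟨h1, h2⟩ := hpq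
    have h3 : ∀ r, (Fin.cons s A : Fin (n+1) → C → Fin v) r p.1 = p.2 ↔ (Fin.cons s A : Fin (n+1) → C → Fin v) r q.1 = q.2 := by
      intro r
      exact Set.ext_iff.1 h2 r
    apply hA
    simp only [Prod.mk.injEq]
    refine ⟨⟨h1, ?_⟩, ?_⟩
    · have := h3 0
      simp only [Fin.cons_zero] at this
      simp [this]
    · ext r
      have := h3 r.succ
      simpa using this

theorem exists_fn_of_multiset (P : Multiset ℕ) (v : ℕ) (h : Multiset.card P = v) :
    ∃ s : Fin v → ℕ, Multiset.map s univ.val = P := by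
  subst h
  induction P using Quotient.inductionOn with
  | _ l =>
    refine ⟨fun i => l.get i, ?_⟩
    change Multiset.map l.get ((List.finRange l.length : List (Fin l.length)) : Multiset (Fin l.length)) = (l : Multiset ℕ)
    rw [Multiset.map_coe, List.map_get_finRange]

theorem construct (N v k M : ℕ) (P : ℕ → Multiset ℕ) (mu : ℕ → ℕ)
    (h1 : ∀ τ < M, mu τ ≠ 0 → Multiset.card (P τ) = v)
    (h2 : ∀ τ < M, mu τ ≠ 0 → (P τ).sum = N)
    (h3 : ∑ τ ∈ range M, mu τ = k)
    (h4 : ∀ i, ∑ τ ∈ range M, mu τ * (P τ).count i ≤ N.choose i) :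
    ∃ A : Fin N → Fin k → Fin v,
        Function.Injective fun p : Fin k × Fin v => {r : Fin N | A r p.1 = p.2} := by
  classical
  have hne : ∀ c : (Σ τ : Fin M, Fin (mu τ)), mu c.1 ≠ 0 := fun c => by
    have := c.2.pos; omega
  have hex : ∀ c : (Σ τ : Fin M, Fin (mu τ)), ∃ s : Fin v → ℕ, Multiset.map s univ.val = P c.1 :=
    fun c => exists_fn_of_multiset _ _ (h1 c.1 c.1.2 (hne c))
  choose m hm using hex
  obtain ⟨A, hA⟩ := baranyai v N Unit (fun _ _ => ()) m
    (by
      intro c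
      rw [← h2 c.1 c.1.2 (hne c), ← hm c]
      rfl)
    (by
      intro _ i
      refine le_trans (le_of_eq ?_) (h4 i)
      simp only [true_and]
      rw [card_filter, Fintype.sum_prod_type, Fintype.sum_sigma, sum_range]
      refine sum_congr rfl fun τ _ => ?_
      rw [sum_congr rfl (g := fun _ => (P τ).count i)]
      · simp
      · intro e _
        rw [← hm ⟨τ, e⟩, Multiset.count_map, ← card_filter]
        simp only [eq_comm (a := i)]
        rfl)
  have hcard : Fintype.card (Σ τ : Fin M, Fin (mu τ)) = k := by
    simp [← h3, sum_range]
  let e := (Fintype.equivFinOfCardEq hcard).symm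
  refine ⟨fun r c => A r (e c), ?_⟩
  intro p q hpq
  have := @hA (e p.1, p.2) (e q.1, q.2) (by simpa using hpq)
  simp only [Prod.mk.injEq] at this
  exact Prod.ext (e.injective this.1) this.2

theorem upper (N v f d k : ℕ) (hd : 0 < d) (hN : N + d = (f + 1) * v)
    (A : Fin N → Fin k → Fin v)
    (hA : Function.Injective fun p : Fin k × Fin v => {r : Fin N | A r p.1 = p.2}) :
    d * k ≤ ∑ i ∈ range (N + 1), N.choose i * min d (f + 1 - i) := by
  classical
  let F : Fin k × Fin v → Finset (Fin N) := fun p => univ.filter fun r => A r p.1 = p.2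
  have hF : Function.Injective F := by
    intro p q hpq
    apply hA
    ext r
    have := Finset.ext_iff.1 hpq r
    simpa [F] using this
  have hcol : ∀ c, d ≤ ∑ σ, min d (f + 1 - #(F (c, σ))) := by
    intro c
    by_cases h : ∃ σ, d ≤ f + 1 - #(F (c, σ))
    · obtain ⟨σ, hσ⟩ := h
      refine le_trans ?_ (single_le_sum (f := fun σ => min d (f + 1 - #(F (c, σ)))) (fun _ _ => Nat.zero_le _) (mem_univ σ))
      simp [hσ]
    · push Not at h
      have h1 : ∑ σ, #(F (c, σ)) = N := by
        have := card_eq_sum_card_fiberwise (s := (univ : Finset (Fin N))) (t := (univ : Finset (Fin v))) (f := fun r => A r c) (by intro r _; simp)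
        simpa [F] using this.symm
      have h2 : ∑ σ : Fin v, (f + 1) ≤ ∑ σ, (min d (f + 1 - #(F (c, σ))) + #(F (c, σ))) := by
        refine sum_le_sum fun σ _ => ?_
        have := h σ
        omega
      rw [sum_add_distrib (f := fun σ => min d (f + 1 - #(F (c, σ)))), h1] at h2
      simp only [sum_const, card_univ, Fintype.card_fin, smul_eq_mul] at h2
      rw [mul_comm v] at h2
      omega
  calc d * k = ∑ c : Fin k, d := by simp [mul_comm]
    _ ≤ ∑ c, ∑ σ, min d (f + 1 - #(F (c, σ))) := sum_le_sum fun c _ => hcol c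
    _ = ∑ p, min d (f + 1 - #(F p)) := by rw [Fintype.sum_prod_type]
    _ = ∑ S ∈ univ.image F, min d (f + 1 - #S) := by rw [sum_image (hF.injOn)]
    _ ≤ ∑ S : Finset (Fin N), min d (f + 1 - #S) := sum_le_sum_of_subset (subset_univ _)
    _ = ∑ i ∈ range (N + 1), N.choose i * min d (f + 1 - i) := by
        have := sum_powerset_apply_card (fun i => min d (f + 1 - i)) (x := (univ : Finset (Fin N)))
        simpa using this

theorem params (N v : ℕ) (hv : 2 ≤ v) (hvN : v ≤ N + 1) :
    ∃ f d, f = (N + 1) / v ∧ d = (f + 1) * v - N ∧ 1 ≤ f ∧ 2 ≤ d ∧ d ≤ v + 1 ∧ N + d = (f + 1) * v := by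
  refine ⟨_, _, rfl, rfl, ?_, ?_⟩
  · exact Nat.div_pos hvN (by omega)
  · have h1 := Nat.div_add_mod (N + 1) v
    have h2 := Nat.mod_lt (N + 1) (show v > 0 by omega)
    have h3 : ((N + 1) / v + 1) * v = v * ((N + 1) / v) + v := by ring
    rw [h3]
    omega

theorem Lam_eq (N v f d : ℕ) (hf : f = (N + 1) / v) (hd : d = (f + 1) * v - N) (hd2 : 2 ≤ d) :
    Lam N v = (∑ i ∈ range (f + 1), N.choose i * min d (f + 1 - i)) / d := by
  unfold Lam
  simp only
  rw [← hf, ← hd]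
  have h1 : ∑ i ∈ range (f + 1), N.choose i * min d (f + 1 - i)
      = (∑ i ∈ Finset.Icc (f + 2 - d) f, (f + 1 - i) * N.choose i) + d * ∑ i ∈ Finset.range (f + 2 - d), N.choose i := by
    rw [← sum_range_add_sum_Ico _ (show f + 2 - d ≤ f + 1 by omega), add_comm, mul_sum]
    congr 1
    · refine sum_congr (by ext; simp) fun i hi => ?_
      simp at hi
      rw [min_eq_right (by omega), mul_comm]
    · refine sum_congr rfl fun i hi => ?_
      simp at hi
      rw [min_eq_left (by omega), mul_comm]
  rw [h1, Nat.add_mul_div_left _ _ (by omega)]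
  
theorem Lam_upper (N v k : ℕ) (hv : 2 ≤ v) (hvN : v ≤ N + 1) (A : Fin N → Fin k → Fin v)
    (hA : Function.Injective fun p : Fin k × Fin v => {r : Fin N | A r p.1 = p.2}) :
    k ≤ Lam N v := by
  obtain ⟨f, d, hf, hd, hf1, hd2, hdv, hN⟩ := params N v hv hvN
  rw [Lam_eq N v f d hf hd hd2, Nat.le_div_iff_mul_le (by omega), mul_comm]
  refine (upper N v f d k (by omega) hN A hA).trans ?_
  have hfN : f ≤ N := by
    have := Nat.mul_le_mul_left (f + 1) hv
    have h3 : N + 1 < 2 * (N + 1) := by omega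
    rw [hf]
    exact Nat.lt_succ_iff.1 (Nat.div_lt_self (by omega) (by omega))
  rw [← sum_range_add_sum_Ico _ (show f + 1 ≤ N + 1 by omega)]
  rw [sum_eq_zero (s := Ico _ _)]
  · simp
  · intro i hi
    simp at hi
    rw [show f + 1 - i = 0 by omega]; simp


theorem choose_mono_sym (N a b : ℕ) (h : a ≤ b) (h2 : a + b ≤ N) : N.choose a ≤ N.choose b := by
  have key : ∀ c, a ≤ c → 2 * c ≤ N → N.choose a ≤ N.choose c := by
    intro c hc
    induction c, hc using Nat.le_induction with
    | base => intro _; exact le_rfl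
    | succ c hc ih =>
      intro h3
      exact (ih (by omega)).trans (Nat.choose_le_succ_of_lt_half_left (by omega))
  by_cases hb : 2 * b ≤ N
  · exact key b h hb
  · rw [← Nat.choose_symm (show b ≤ N by omega)]
    exact key _ (by omega) (by omega)

theorem geo_step (N f E i : ℕ) (hE : N + 1 = 2 * f + E) (hi : i + 1 ≤ f) :
    (f + E) * N.choose i ≤ f * N.choose (i + 1) := by
  have h := Nat.choose_succ_right_eq N i
  calc (f + E) * N.choose i ≤ N.choose i * (N - i) := by
        rw [mul_comm]; exact Nat.mul_le_mul_left _ (by omega)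
    _ = N.choose (i + 1) * (i + 1) := h.symm
    _ ≤ f * N.choose (i + 1) := by rw [mul_comm]; exact Nat.mul_le_mul_right _ hi

theorem geo (N f E j : ℕ) (hE : N + 1 = 2 * f + E) (hj : j ≤ f) :
    E * ∑ i ∈ range j, N.choose i ≤ f * N.choose j := by
  induction j with
  | zero => simp
  | succ j ih =>
    rw [sum_range_succ, mul_add]
    have h1 := ih (by omega)
    have h2 := geo_step N f E j hE hj
    nlinarith

theorem geo' (N f E w j : ℕ) (hE : N + 1 = 2 * f + E) (hj : j ≤ f) (hf : 1 ≤ f) (hw : f * w ≤ E) :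
    w * ∑ i ∈ range j, N.choose i ≤ N.choose j := by
  have h := geo N f E j hE hj
  refine Nat.le_of_mul_le_mul_left (le_trans ?_ h) hf
  rw [← mul_assoc]
  exact Nat.mul_le_mul_right _ hw

theorem double (N f E i : ℕ) (hE : N + 1 = 2 * f + E) (hi : i + 1 ≤ f) (hfE : f ≤ E) :
    2 * N.choose i ≤ N.choose (i + 1) := by
  have h := geo_step N f E i hE hi
  refine Nat.le_of_mul_le_mul_left (le_trans ?_ h) (show 0 < f by omega)
  rw [← mul_assoc]
  exact Nat.mul_le_mul_right _ (by omega)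

def tinyterm (N f d : ℕ) : ℕ := if d ≤ f + 1 then N.choose (f + 1 - d) else 0

/-- numeric inequality, case `d ≤ v` -/
theorem case1_ineq (N f E w d q : ℕ) (hE : N + 1 = 2 * f + E) (hEd : E + d = (f + 1) * w + 3)
    (hf : 1 ≤ f) (hd2 : 2 ≤ d) (hdv : d ≤ w + 2) (hq : d * q ≤ N.choose f) :
    w * (∑ i ∈ range f, N.choose i) + tinyterm N f d + (w + 2 - d) * q ≤ N.choose (f + 1) := by
  have hkey := Nat.choose_succ_right_eq N f
  have hNf : N - f + d = (f + 1) * (w + 1) + 1 := by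
    have : (f + 1) * (w + 1) = (f + 1) * w + f + 1 := by ring
    omega
  set X := N - f with hX
  set T := ∑ i ∈ range f, N.choose i with hT
  set a := N.choose f with ha
  set z := N.choose (f + 1) with hz
  rcases Nat.eq_zero_or_pos w with hw | hw
  · subst hw
    have hd : d = 2 := by omega
    subst hd
    have : tinyterm N f 2 = z := by
      rw [tinyterm, if_pos (by omega), hz]
      exact Nat.choose_symm_of_eq_add (by omega)
    simp [this]
  have hfw : f ≤ f * w := Nat.le_mul_of_pos_right f hw
  have hexp : (f + 1) * w = f * w + w := by ring
  have hEf : f ≤ E := by omega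
  rcases Nat.lt_or_ge d 3 with hd | hd
  · have hd : d = 2 := by omega
    subst hd
    have h1 := geo N f E f hE le_rfl
    rw [← hT, ← ha] at h1
    have hE' : E = (f + 1) * w + 1 := by omega
    have ht : 2 * tinyterm N f 2 ≤ a := by
      rw [tinyterm, if_pos (by omega)]
      have := double N f E (f - 1) hE (by omega) hEf
      rw [show f - 1 + 1 = f by omega] at this
      exact this
    have h2 : (f + 1) * (w * T) ≤ f * a := by
      refine le_trans ?_ h1
      rw [hE']; nlinarith
    have hX' : X + 1 = (f + 1) * (w + 1) := by omega
    simp only [Nat.add_sub_cancel]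
    set t := tinyterm N f 2
    refine Nat.le_of_mul_le_mul_left ?_ (show 0 < 2 * (f + 1) by omega)
    have hz2 : z * (f + 1) + a = a * ((f + 1) * (w + 1)) := by rw [hkey, ← hX']; ring
    have h3 : (f + 1) * w * (2 * q) ≤ (f + 1) * w * a := Nat.mul_le_mul_left _ hq
    have h4 : (f + 1) * (2 * t) ≤ (f + 1) * a := Nat.mul_le_mul_left _ ht
    have h5 : (f + 1) * a * 1 ≤ (f + 1) * a * w := Nat.mul_le_mul_left _ hw
    nlinarith
  rcases Nat.lt_or_ge f 2 with hf2 | hf2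
  · have hf1 : f = 1 := by omega
    subst hf1
    have hT1 : T = 1 := by simp [hT]
    have ht : tinyterm N 1 d = 0 := by rw [tinyterm, if_neg (by omega)]
    have ha1 : a = N := by simp [ha]
    rw [hT1, ht]
    rw [ha1] at hq hkey
    obtain ⟨e, he⟩ := Nat.exists_eq_add_of_le hdv
    have hN : N = w + 2 + e := by omega
    have hX' : X = w + 1 + e := by omega
    have he' : w + 2 - d = e := by omega
    rw [he']
    refine Nat.le_of_mul_le_mul_left ?_ (show 0 < 2 * d by omega)
    have h2 : 2 * (w + 2) ≤ d * X := by
      obtain ⟨g, rfl⟩ := Nat.exists_eq_add_of_le hd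
      rw [hX']; nlinarith
    have h3 : N * (2 * (w + 2)) ≤ N * (d * X) := Nat.mul_le_mul_left _ h2
    have h4 : e * (d * q) ≤ e * N := Nat.mul_le_mul_left _ hq
    have h5 : d * w ≤ d * N := Nat.mul_le_mul_left _ (by omega)
    nlinarith
  · have h1 : w * T ≤ a := geo' N f E w f hE le_rfl hf (by omega)
    have ht : 4 * tinyterm N f d ≤ a := by
      rw [tinyterm]
      split_ifs with hdf
      · have h6 := double N f E (f - 1) hE (by omega) hEf
        have h7 := double N f E (f - 2) hE (by omega) hEf
        rw [show f - 1 + 1 = f by omega] at h6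
        rw [show f - 2 + 1 = f - 1 by omega] at h7
        have h8 := choose_mono_sym N (f + 1 - d) (f - 2) (by omega) (by omega)
        omega
      · simp
    set t := tinyterm N f d
    obtain ⟨e, he⟩ := Nat.exists_eq_add_of_le hdv
    have he' : w + 2 - d = e := by omega
    rw [he']
    -- 3 z + a (d-1) ≥ 3 a (w+1)
    have hz3 : 3 * a * (w + 1) ≤ 3 * z + a * (d - 1) := by
      refine Nat.le_of_mul_le_mul_left ?_ (show 0 < f + 1 by omega)
      obtain ⟨g, rfl⟩ := Nat.exists_eq_add_of_le (show 1 ≤ d by omega)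
      have hX' : X + g = (f + 1) * (w + 1) := by omega
      have : z * (f + 1) + a * g = a * ((f + 1) * (w + 1)) := by rw [hkey, ← hX']; ring
      simp only [Nat.add_sub_cancel_left]
      have h9 : 3 * (a * g) ≤ (f + 1) * (a * g) := Nat.mul_le_mul_right _ (by omega)
      nlinarith
    refine Nat.le_of_mul_le_mul_left ?_ (show 0 < 12 * d by omega)
    obtain ⟨g, rfl⟩ := Nat.exists_eq_add_of_le hd
    have hw' : w = g + 1 + e := by omega
    have h3 : e * ((3 + g) * q) ≤ e * a := Nat.mul_le_mul_left _ hq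
    have h4 : (3 + g) * (w * T) ≤ (3 + g) * a := Nat.mul_le_mul_left _ h1
    have h5 : (3 + g) * (4 * t) ≤ (3 + g) * a := Nat.mul_le_mul_left _ ht
    have h6 : (3 + g) * (3 * a * (w + 1)) ≤ (3 + g) * (3 * z + a * (2 + g)) := by
      refine Nat.mul_le_mul_left _ (hz3.trans (le_of_eq ?_))
      congr 2; omega
    rw [hw'] at h6 h4 ⊢
    have h7 : a * (15 * (3 + g) + 12 * e) + 4 * ((3+g) * (a * (2+g))) ≤ 4 * ((3 + g) * (3 * a * (g + 1 + e + 1))) := by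
      have h8 : 4 * ((3 + g) * (3 * a * (g + 1 + e + 1))) = a * (15 * (3 + g) + 12 * e) + 4 * ((3+g) * (a * (2+g))) + a * (3 + 25 * g + 8 * g * g + 24 * e + 12 * g * e) := by ring
      rw [h8]; exact Nat.le_add_right _ _
    linarith

/-- numeric inequality, case `d = v + 1` -/
theorem case2_ineq (N f w S s : ℕ) (hE : N + 1 = 2 * f + f * w)
    (hf : 1 ≤ f) (hS : S ≤ w * ∑ i ∈ range (f - 1), N.choose i) (hs : s = (S + (w + 2)) / (w + 3)) :
    N.choose f = (w + 1) * N.choose (f - 1) ∧ 2 * s ≤ N.choose (f - 1) ∧ (w = 0 → s = 0) ∧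
    w * (∑ i ∈ range (f - 1), N.choose i) + tinyterm N f (w + 3) + s ≤ N.choose (f + 1) := by
  have hB : N.choose f = (w + 1) * N.choose (f - 1) := by
    have h := Nat.choose_succ_right_eq N (f - 1)
    rw [show f - 1 + 1 = f by omega] at h
    have h2 : N - (f - 1) = f * (w + 1) := by
      have : f * (w + 1) = f * w + f := by ring
      omega
    rw [h2] at h
    refine Nat.eq_of_mul_eq_mul_right hf ?_
    rw [h]; ring
  have h0 : S = 0 → s = 0 := by
    rintro rfl
    rw [hs]; exact Nat.div_eq_of_lt (by omega)
  have hw0 : w = 0 → s = 0 := by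
    rintro rfl
    exact h0 (by simpa using hS)
  refine ⟨hB, ?_, hw0, ?_⟩
  all_goals
    rcases Nat.lt_or_ge f 2 with hf2 | hf2
    · have hf1 : f = 1 := by omega
      subst hf1
      have : s = 0 := h0 (by simpa using hS)
      simp [this, tinyterm]
    rcases Nat.eq_zero_or_pos w with hw | hw
    · have hsz := hw0 hw
      subst hw
      rw [hsz]
      first
      | simp; done
      | rw [tinyterm, if_pos (by omega)]
        have : N.choose (f + 1 - (0 + 3)) = N.choose (f + 1) := Nat.choose_symm_of_eq_add (by omega)
        simp at this ⊢
        omega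
    have hfw : f ≤ f * w := Nat.le_mul_of_pos_right f hw
    have h1 : w * ∑ i ∈ range (f - 1), N.choose i ≤ N.choose (f - 1) :=
      geo' N f (f * w) w (f - 1) hE (by omega) hf le_rfl
    have h2 := double N f (f * w) (f - 2) hE (by omega) hfw
    rw [show f - 2 + 1 = f - 1 by omega] at h2
    have h3 : 0 < N.choose (f - 2) := Nat.choose_pos (by omega)
    have h4 : (w + 3) * s ≤ S + (w + 2) := by rw [hs]; exact Nat.mul_div_le _ _
    have h5 : 2 * s ≤ N.choose (f - 1) := by
      by_contra hcon
      push Not at hcon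
      have : (w + 3) * (N.choose (f - 1) + 1) ≤ (w + 3) * (2 * s) := Nat.mul_le_mul_left _ hcon
      have h9 : (w + 1) * 2 ≤ (w + 1) * N.choose (f - 1) := Nat.mul_le_mul_left _ (by omega)
      nlinarith
  · exact h5
  · have ht : 2 * tinyterm N f (w + 3) ≤ N.choose (f - 1) := by
      rw [tinyterm]
      split_ifs with hdf
      · have h8 := choose_mono_sym N (f + 1 - (w + 3)) (f - 2) (by omega) (by omega)
        omega
      · simp
    have hkey := Nat.choose_succ_right_eq N f
    rw [hB] at hkey
    have h6 : 2 * N.choose (f - 1) ≤ N.choose (f + 1) := by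
      refine Nat.le_of_mul_le_mul_left ?_ (show 0 < f + 1 by omega)
      have h7 : f + 1 ≤ N - f := by omega
      have h8 : 2 * (f + 1) ≤ (w + 1) * (N - f) := Nat.mul_le_mul (by omega) h7
      have := Nat.mul_le_mul_left (N.choose (f - 1)) h8
      nlinarith
    omega

def prof (f d w τ : ℕ) : Multiset ℕ :=
  τ ::ₘ ((f + 1) + (f + 1 - (d + τ))) ::ₘ
    (Multiset.replicate (d + τ - (f + 1)) f + Multiset.replicate (w - (d + τ - (f + 1))) (f + 1))

theorem prof_card (f d w τ : ℕ) (h : d + τ - (f + 1) ≤ w) : Multiset.card (prof f d w τ) = w + 2 := by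
  simp [prof]; omega

theorem prof_sum (N f d w τ : ℕ) (h : d + τ - (f + 1) ≤ w) (hN : N + d = (f + 1) * (w + 2)) :
    (prof f d w τ).sum = N := by
  simp only [prof, Multiset.sum_cons, Multiset.sum_add, Multiset.sum_replicate, smul_eq_mul]
  obtain ⟨e, he⟩ := Nat.exists_eq_add_of_le h
  set b := d + τ - (f + 1) with hb
  have h1 : w - b = e := by omega
  rw [h1]
  have h2 : (f + 1) * (w + 2) = b * f + e * (f + 1) + b + (f + 1) + (f + 1) := by rw [he]; ring
  omega

theorem prof_count (f d w τ i : ℕ) : (prof f d w τ).count i =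
    (if i = τ then 1 else 0) + (if i = (f + 1) + (f + 1 - (d + τ)) then 1 else 0)
      + (if i = f then d + τ - (f + 1) else 0) + (if i = f + 1 then w - (d + τ - (f + 1)) else 0) := by
  simp only [prof, Multiset.count_cons, Multiset.count_add, Multiset.count_replicate, eq_comm (b := i)]
  omega

theorem prof_lt (N f d w M i : ℕ) (hM : M ≤ f) (hi : i < f) :
    ∑ τ ∈ range M, N.choose τ * (prof f d w τ).count i = if i < M then N.choose i else 0 := by
  have : ∀ τ ∈ range M, N.choose τ * (prof f d w τ).count i = if i = τ then N.choose τ else 0 := by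
    intro τ _
    rw [prof_count, if_neg (show ¬ i = (f + 1) + (f + 1 - (d + τ)) by omega), if_neg (show ¬ i = f by omega),
      if_neg (show ¬ i = f + 1 by omega)]
    simp
  rw [sum_congr rfl this, sum_ite_eq]
  simp

theorem prof_f (N f d w M : ℕ) (hM : M ≤ f) :
    ∑ τ ∈ range M, N.choose τ * (prof f d w τ).count f = ∑ τ ∈ range M, N.choose τ * (d + τ - (f + 1)) := by
  refine sum_congr rfl fun τ hτ => ?_
  simp at hτ
  rw [prof_count, if_neg (show ¬ f = τ by omega), if_neg (show ¬ f = (f + 1) + (f + 1 - (d + τ)) by omega), if_pos rfl,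
    if_neg (show ¬ f = f + 1 by omega)]
  simp

theorem prof_f1 (N f d w M : ℕ) (hM : M ≤ f) (hb : ∀ τ < M, d + τ - (f + 1) ≤ w) :
    ∑ τ ∈ range M, N.choose τ * (prof f d w τ).count (f + 1) ≤
      w * (∑ τ ∈ range M, N.choose τ) + tinyterm N f d := by
  have h1 : ∀ τ ∈ range M, N.choose τ * (prof f d w τ).count (f + 1) ≤
      w * N.choose τ + if d + τ = f + 1 then N.choose τ else 0 := by
    intro τ hτ
    simp at hτ
    have := hb τ hτ
    have h2 : (prof f d w τ).count (f + 1) ≤ w + if d + τ = f + 1 then 1 else 0 := by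
      rw [prof_count]
      simp only [if_true]
      split_ifs <;> omega
    refine (Nat.mul_le_mul_left _ h2).trans (le_of_eq ?_)
    split_ifs <;> ring
  refine (sum_le_sum h1).trans ?_
  rw [sum_add_distrib, ← mul_sum]
  refine Nat.add_le_add_left ?_ _
  unfold tinyterm
  split_ifs with hd
  · calc _ ≤ ∑ τ ∈ range M, if f + 1 - d = τ then N.choose τ else 0 := by
          refine sum_le_sum fun τ _ => ?_
          split_ifs <;> first | omega | exact le_rfl
      _ ≤ _ := by
          rw [sum_ite_eq]; split_ifs <;> simp
  · rw [sum_eq_zero]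
    intro τ _
    rw [if_neg (by omega)]

theorem prof_big (N f d w M i : ℕ) (hM : M ≤ f) (hi : f + 1 < i) (hN : 2 * f + 2 ≤ N + d) :
    ∑ τ ∈ range M, N.choose τ * (prof f d w τ).count i ≤ N.choose i := by
  calc _ ≤ ∑ τ ∈ range M, if 2 * f + 2 - d - i = τ then N.choose i else 0 := by
        refine sum_le_sum fun τ hτ => ?_
        simp at hτ
        rw [prof_count, if_neg (show ¬ i = τ by omega), if_neg (show ¬ i = f by omega), if_neg (show ¬ i = f + 1 by omega)]
        by_cases h : i = (f + 1) + (f + 1 - (d + τ))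
        · rw [if_pos h, if_pos (by omega)]
          simpa using choose_mono_sym N τ i (by omega) (by omega)
        · rw [if_neg h]; simp
    _ ≤ _ := by
        rw [sum_ite_eq]; split_ifs <;> simp

theorem exists1 (N f d w k : ℕ) (hf : 1 ≤ f) (hd2 : 2 ≤ d) (hdv : d ≤ w + 2)
    (hN : N + d = (f + 1) * (w + 2))
    (hk : k = (∑ i ∈ range (f + 1), N.choose i * min d (f + 1 - i)) / d) :
    ∃ A : Fin N → Fin k → Fin (w + 2),
        Function.Injective fun p : Fin k × Fin (w + 2) => {r : Fin N | A r p.1 = p.2} := by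
  set S := ∑ τ ∈ range f, N.choose τ * (d + τ - (f + 1)) with hS
  set T := ∑ τ ∈ range f, N.choose τ with hT
  have hexp : (f + 1) * (w + 2) = f * w + w + 2 * f + 2 := by ring
  have hexp2 : (f + 1) * w = f * w + w := by ring
  have hST : S ≤ w * T := by
    rw [hS, hT, mul_sum]
    refine sum_le_sum fun τ hτ => ?_
    simp at hτ
    rw [mul_comm]
    exact Nat.mul_le_mul_right _ (by omega)
  have hSn : S ≤ N.choose f := hST.trans (geo' N f (N + 1 - 2 * f) w f (by omega) le_rfl hf (by omega))
  set q := (N.choose f - S) / d with hq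
  have hqd : d * q ≤ N.choose f - S := Nat.mul_div_le _ _
  have hineq := case1_ineq N f (N + 1 - 2 * f) w d q (by omega) (by omega) hf hd2 hdv (by omega)
  refine construct N (w + 2) k (f + 1)
    (fun τ => if τ < f then prof f d w τ else Multiset.replicate d f + Multiset.replicate (w + 2 - d) (f + 1))
    (fun τ => if τ < f then N.choose τ else q) ?_ ?_ ?_ ?_
  · intro τ hτ _
    by_cases h : τ < f
    · simp only [h, if_true]
      exact prof_card f d w τ (by omega)
    · simp only [h, if_false]
      simp; omega
  · intro τ hτ _
    by_cases h : τ < f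
    · simp only [h, if_true]
      exact prof_sum N f d w τ (by omega) hN
    · simp only [h, if_false]
      simp only [Multiset.sum_add, Multiset.sum_replicate, smul_eq_mul]
      obtain ⟨e, he⟩ := Nat.exists_eq_add_of_le hdv
      rw [show w + 2 - d = e by omega]
      rw [he] at hN
      have : (f + 1) * (d + e) = d * f + e * (f + 1) + d := by ring
      omega
  · rw [sum_range_succ, if_neg (lt_irrefl f)]
    rw [sum_congr rfl (g := fun τ => N.choose τ) (by intro τ hτ; simp at hτ; simp [hτ])]
    rw [hk]
    have h1 : (∑ i ∈ range (f + 1), N.choose i * min d (f + 1 - i)) + S = N.choose f + d * T := by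
      rw [sum_range_succ, show f + 1 - f = 1 by omega, min_eq_right (by omega), mul_one, add_right_comm, hS,
        ← sum_add_distrib, hT, mul_sum, add_comm]
      congr 1
      refine sum_congr rfl fun τ hτ => ?_
      simp at hτ
      rw [← mul_add, show min d (f + 1 - τ) + (d + τ - (f + 1)) = d by omega, mul_comm]
    rw [show (∑ i ∈ range (f + 1), N.choose i * min d (f + 1 - i)) = (N.choose f - S) + d * T by omega,
      Nat.add_mul_div_left _ _ (by omega), add_comm]
  · intro i
    rw [sum_range_succ]
    simp only [lt_irrefl, if_false]
    rw [sum_congr rfl (g := fun τ => N.choose τ * (prof f d w τ).count i) (by intro τ hτ; simp at hτ; simp [hτ])]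
    simp only [Multiset.count_add, Multiset.count_replicate]
    rcases lt_trichotomy i f with h | h | h
    · rw [prof_lt _ _ _ _ _ _ le_rfl h, if_pos h, if_neg (by omega), if_neg (by omega)]; simp
    · subst h
      rw [prof_f _ _ _ _ _ le_rfl, if_pos rfl, if_neg (by omega), ← hS, add_zero, mul_comm q]
      omega
    · rcases Nat.eq_or_lt_of_le (show f + 1 ≤ i from h) with h | h
      · subst h
        have := prof_f1 N f d w f le_rfl (by intro τ hτ; omega)
        rw [if_neg (by omega), if_pos rfl, zero_add, mul_comm q]
        exact (Nat.add_le_add_right this _).trans hineq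
      · have := prof_big N f d w f i le_rfl h (by omega)
        rw [if_neg (by omega), if_neg (by omega)]
        simpa using this

theorem exists2 (N f w k : ℕ) (hf : 1 ≤ f)
    (hN : N + (w + 3) = (f + 1) * (w + 2))
    (hk : k = (∑ i ∈ range (f + 1), N.choose i * min (w + 3) (f + 1 - i)) / (w + 3)) :
    ∃ A : Fin N → Fin k → Fin (w + 2),
        Function.Injective fun p : Fin k × Fin (w + 2) => {r : Fin N | A r p.1 = p.2} := by
  obtain ⟨h, rfl⟩ := Nat.exists_eq_add_of_le' hf
  set d := w + 3 with hd
  set S := ∑ τ ∈ range h, N.choose τ * (d + τ - (h + 1 + 1)) with hS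
  set T := ∑ τ ∈ range h, N.choose τ with hT
  have hexp : (h + 1 + 1) * (w + 2) = (h + 1) * w + w + 2 * h + 4 := by ring
  have hST : S ≤ w * T := by
    rw [hS, hT, mul_sum]
    refine sum_le_sum fun τ hτ => ?_
    simp at hτ
    rw [mul_comm]
    exact Nat.mul_le_mul_right _ (by omega)
  obtain ⟨s, hs⟩ : ∃ s, s = (S + (w + 2)) / (w + 3) := ⟨_, rfl⟩
  obtain ⟨hB, h2s, hw0, hineq⟩ := case2_ineq N (h + 1) w S s (by omega) hf (by simpa using hST) hs
  simp only [Nat.add_sub_cancel] at hB h2s hineq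
  rw [← hT, ← hd] at hineq
  set B := N.choose h with hBdef
  have hsS : S ≤ d * s := by
    have h1 := Nat.div_add_mod (S + (w + 2)) (w + 3)
    have h2 := Nat.mod_lt (S + (w + 2)) (show w + 3 > 0 by omega)
    rw [← hs, ← hd] at h1
    rw [← hd] at h2
    omega
  have hsS2 : d * s ≤ S + (w + 2) := by rw [hs]; exact Nat.mul_div_le _ _
  refine construct N (w + 2) k (h + 2)
    (fun τ => if τ < h then prof (h + 1) d w τ else if τ = h then
        h ::ₘ Multiset.replicate (w + 1) (h + 1)
      else (h + 2) ::ₘ (Multiset.replicate 2 h + Multiset.replicate (w - 1) (h + 1)))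
    (fun τ => if τ < h then N.choose τ else if τ = h then B - 2 * s else s) ?_ ?_ ?_ ?_
  · intro τ hτ hmu
    by_cases h1 : τ < h
    · simp only [h1, if_true]
      exact prof_card _ d w τ (by omega)
    by_cases h2 : τ = h
    · simp [h2]
    · simp only [h1, h2, if_false] at hmu ⊢
      have : w ≠ 0 := fun h => hmu (hw0 h)
      simp; omega
  · intro τ hτ hmu
    by_cases h1 : τ < h
    · simp only [h1, if_true]
      exact prof_sum N _ d w τ (by omega) hN
    by_cases h2 : τ = h
    · simp only [h2, lt_irrefl, if_true, if_false, Multiset.sum_cons, Multiset.sum_replicate, smul_eq_mul]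
      have : (w + 1) * (h + 1) = (h + 1) * w + h + 1 := by ring
      omega
    · simp only [h1, h2, if_false] at hmu ⊢
      have : w ≠ 0 := fun h => hmu (hw0 h)
      obtain ⟨e, rfl⟩ := Nat.exists_eq_succ_of_ne_zero this
      simp only [Multiset.sum_cons, Multiset.sum_add, Multiset.sum_replicate, smul_eq_mul, Nat.succ_eq_add_one, Nat.add_sub_cancel] at *
      have : (h + 1) * (e + 1) = e * (h + 1) + h + 1 := by ring
      omega
  · rw [sum_range_succ, sum_range_succ]
    rw [sum_congr rfl (g := fun τ => N.choose τ) (by intro τ hτ; simp at hτ; simp [hτ])]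
    rw [← hT]
    simp only [lt_irrefl, if_false, if_true, show ¬ (h + 1 < h) by omega, show ¬ (h + 1 = h) by omega]
    rw [hk]
    have h1 : (∑ i ∈ range (h + 1 + 1), N.choose i * min d (h + 1 + 1 - i)) + S = d * B + d * T := by
      rw [sum_range_succ, sum_range_succ, show h + 1 + 1 - (h + 1) = 1 by omega, show h + 1 + 1 - h = 2 by omega,
        min_eq_right (by omega), min_eq_right (by omega), mul_one, hB, ← hBdef]
      have : (∑ i ∈ range h, N.choose i * min d (h + 1 + 1 - i)) + S = d * T := by
        rw [hS, ← sum_add_distrib, hT, mul_sum]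
        refine sum_congr rfl fun τ hτ => ?_
        simp at hτ
        rw [← mul_add, show min d (h + 1 + 1 - τ) + (d + τ - (h + 1 + 1)) = d by omega, mul_comm]
      rw [← this, hd]
      ring
    symm
    obtain ⟨y, hy⟩ := Nat.exists_eq_add_of_le (show s ≤ B by omega)
    have h3 : d * B = d * s + d * y := by rw [hy]; ring
    rw [show T + (B - 2 * s) + s = T + y by omega]
    rw [show (∑ i ∈ range (h + 1 + 1), N.choose i * min d (h + 1 + 1 - i)) = (d * s - S) + d * (T + y) by
      rw [mul_add]; omega]
    rw [Nat.add_mul_div_left _ _ (by omega), Nat.div_eq_of_lt (by omega), zero_add]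
  · intro i
    rw [sum_range_succ, sum_range_succ]
    rw [sum_congr rfl (g := fun τ => N.choose τ * (prof (h + 1) d w τ).count i) (by intro τ hτ; simp at hτ; simp [hτ])]
    simp only [lt_irrefl, if_false, if_true, show ¬ (h + 1 < h) by omega, show ¬ (h + 1 = h) by omega]
    simp only [Multiset.count_cons, Multiset.count_add, Multiset.count_replicate]
    rcases lt_trichotomy i h with h1 | h1 | h1
    · rw [prof_lt _ _ _ _ _ _ (by omega) (by omega), if_pos h1]
      simp [show h ≠ i by omega, show h + 1 ≠ i by omega, show h + 2 ≠ i by omega, show i ≠ h by omega, show i ≠ h + 2 by omega]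
    · subst h1
      rw [prof_lt _ _ _ _ _ _ (by omega) (by omega), if_neg (by omega)]
      simp
      omega
    rcases Nat.eq_or_lt_of_le (show h + 1 ≤ i from h1) with h1 | h1
    · subst h1
      rw [prof_f _ _ _ _ _ (by omega), ← hS]
      simp
      rw [hB]
      rcases Nat.eq_zero_or_pos w with hw | hw
      · have hs0 := hw0 hw
        have : S = 0 := by rw [hw] at hST; omega
        rw [hs0, this]; simp [hw]
      · obtain ⟨e, rfl⟩ := Nat.exists_eq_add_of_le' hw
        obtain ⟨y, hy⟩ := Nat.exists_eq_add_of_le h2s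
        rw [show B - 2 * s = y by omega, hy]
        rw [hd] at hsS
        simp only [Nat.add_sub_cancel]
        nlinarith
    rcases Nat.eq_or_lt_of_le (show h + 1 + 1 ≤ i from h1) with h1 | h1
    · subst h1
      have := prof_f1 N (h + 1) d w h (by omega) (by intro τ hτ; omega)
      simp [show ¬ (h + 1 + 1 = h) by omega, show ¬ (h = h + 1 + 1) by omega]
      rw [← hT] at this
      omega
    · have := prof_big N (h + 1) d w h i (by omega) h1 (by omega)
      simp [show h ≠ i by omega, show h + 1 ≠ i by omega, show h + 2 ≠ i by omega, show i ≠ h by omega, show i ≠ h + 2 by omega]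
      exact this

end LocArr

theorem stmt0 (N v : ℕ) (hv : 2 ≤ v) (hvN : v ≤ N + 1) :
    IsGreatest {k : ℕ | ∃ A : Fin N → Fin k → Fin v,
        Function.Injective fun p : Fin k × Fin v => {r : Fin N | A r p.1 = p.2}}
      (Lam N v) := by
  constructor
  · obtain ⟨f, d, hf, hd, hf1, hd2, hdv, hN⟩ := LocArr.params N v hv hvN
    have hk := LocArr.Lam_eq N v f d hf hd hd2
    obtain ⟨w, rfl⟩ := Nat.exists_eq_add_of_le' hv
    rcases Nat.lt_or_ge (w + 2) d with h | h
    · have hd3 : d = w + 3 := by omega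
      rw [hd3] at hN hk
      exact LocArr.exists2 N f w _ hf1 hN hk
    · exact LocArr.exists1 N f d w _ hf1 hd2 h hN hk
  · rintro k ⟨A, hA⟩
    exact LocArr.Lam_upper N v k hv hvN A hA
end

section
/- Let N, u, and v be positive integers with uv ≤ N, and write C(N,u) = αv + β with 0 ≤ β < v. Then the collection of all u-element subsets of an N-element set can be partitioned into α classes each consisting of v pairwise disjoint u-subsets, together with (when β > 0) one further class consisting of β pairwise disjoint u-subsets. -/
open Finset in
theorem frac_hall {J I : Type} [Fintype J] [Fintype I] [DecidableEq I] [DecidableEq J] (w : J → I → ℚ)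
    (h0 : ∀ j i, 0 ≤ w j i) (hr : ∀ j, ∑ i, w j i = 1) (hc : ∀ i, ∑ j, w j i ≤ 1) :
    ∃ f : J → I, Function.Injective f ∧ ∀ j, w j (f j) ≠ 0 := by
  classical
  let t : J → Finset I := fun j => univ.filter (fun i => w j i ≠ 0)
  have := (Finset.all_card_le_biUnion_card_iff_exists_injective t).1 (by
    intro A
    have h1 : (A.card : ℚ) = ∑ j ∈ A, ∑ i ∈ A.biUnion t, w j i := by
      rw [Finset.card_eq_sum_ones]; push_cast
      apply Finset.sum_congr rfl
      intro j hj
      rw [← hr j]; symm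
      apply Finset.sum_subset (subset_univ _)
      intro i _ hi
      by_contra hne
      exact hi (mem_biUnion.2 ⟨j, hj, by simp [t, hne]⟩)
    have h2 : ∑ j ∈ A, ∑ i ∈ A.biUnion t, w j i ≤ ((A.biUnion t).card : ℚ) := by
      rw [Finset.sum_comm, Finset.card_eq_sum_ones]; push_cast
      apply Finset.sum_le_sum
      intro i _
      exact (Finset.sum_le_univ_sum_of_nonneg (fun j => h0 j i)).trans (hc i)
    exact_mod_cast h1.le.trans h2)
  obtain ⟨f, hf, hm⟩ := this
  exact ⟨f, hf, fun j => by simpa [t] using hm j⟩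

open Finset in
theorem frac_assign {T I : Type} [Fintype T] [Fintype I] [DecidableEq I] [DecidableEq T]
    (a : I → T → ℚ) (c : T → ℕ)
    (h0 : ∀ i t, 0 ≤ a i t) (hr : ∀ i, ∑ t, a i t = 1) (hc : ∀ t, ∑ i, a i t = c t) :
    ∃ g : I → T, (∀ i, a i (g i) ≠ 0) ∧ ∀ t, (univ.filter (fun i => g i = t)).card = c t := by
  classical
  obtain ⟨f, hf, hne⟩ := frac_hall (J := Σ t, Fin (c t)) (fun j i => a i j.1 / c j.1)
    (fun j i => div_nonneg (h0 _ _) (by positivity))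
    (by
      rintro ⟨t, k⟩
      have : (c t : ℚ) ≠ 0 := by
        have := k.pos
        positivity
      simp only
      rw [← Finset.sum_div, hc, div_self this])
    (by
      intro i
      rw [Fintype.sum_sigma, ← hr i]
      apply Finset.sum_le_sum
      intro t _
      simp only [sum_const, card_univ, Fintype.card_fin, nsmul_eq_mul]
      by_cases h : (c t : ℚ) = 0
      · simp [h, h0]
      · rw [mul_div_cancel₀ _ h])
  have hcard : Fintype.card (Σ t, Fin (c t)) = Fintype.card I := by
    have : (∑ t, (c t : ℚ)) = Fintype.card I := by
      simp_rw [← hc]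
      rw [Finset.sum_comm]
      simp [hr]
    simp only [Fintype.card_sigma, Fintype.card_fin]
    exact_mod_cast this
  have hb : Function.Bijective f := (Fintype.bijective_iff_injective_and_card f).2 ⟨hf, hcard⟩
  let F := Equiv.ofBijective f hb
  refine ⟨fun i => (F.symm i).1, ?_, ?_⟩
  · intro i h
    have := hne (F.symm i)
    have e : f (F.symm i) = i := F.apply_symm_apply i
    rw [e] at this
    simp [h] at this
  · intro t
    have : (univ.filter (fun i => (F.symm i).1 = t)) =
      (univ : Finset (Fin (c t))).image (fun k => f ⟨t, k⟩) := by
      ext i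
      simp only [mem_filter, mem_univ, true_and, mem_image]
      constructor
      · intro h
        subst h
        exact ⟨(F.symm i).2, F.apply_symm_apply i⟩
      · rintro ⟨k, rfl⟩
        have : F.symm (f ⟨t, k⟩) = ⟨t, k⟩ := F.symm_apply_apply ⟨t, k⟩
        rw [this]
    rw [this, card_image_of_injective]
    · simp
    · intro k k' h
      simpa using hf h

open Finset in
theorem frac_pick {E T I : Type} [Fintype E] [Fintype T] [Fintype I] [DecidableEq I] [DecidableEq T]
    [DecidableEq E]
    (cls : E → I) (s : E → T) (w : T → ℚ) (c : T → ℕ) (h0 : ∀ t, 0 ≤ w t)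
    (hc : ∀ t, ∑ e with s e = t, w (s e) = c t) (hr : ∀ i, ∑ e with cls e = i, w (s e) ≤ 1) :
    ∃ X : Finset E, (∀ e ∈ X, ∀ e' ∈ X, cls e = cls e' → e = e') ∧
      (∀ t, (X.filter (fun e => s e = t)).card = c t) ∧ (∀ e ∈ X, w (s e) ≠ 0) ∧
      ∀ i, ∑ e with cls e = i, w (s e) = 1 → ∃ e ∈ X, cls e = i := by
  classical
  let b : I → T → ℚ := fun i t => ∑ e with cls e = i ∧ s e = t, w (s e)
  have hb0 : ∀ i t, 0 ≤ b i t := fun i t => Finset.sum_nonneg fun e _ => h0 _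
  have hbr : ∀ i, ∑ t, b i t = ∑ e with cls e = i, w (s e) := by
    intro i
    rw [← Finset.sum_fiberwise _ s]
    simp only [b, filter_filter]
  have hbc : ∀ t, ∑ i, b i t = c t := by
    intro t
    rw [← hc, ← Finset.sum_fiberwise _ cls]
    simp only [b, filter_filter, and_comm]
  have hle : ∑ t, c t ≤ Fintype.card I := by
    have : ∑ t, (c t : ℚ) ≤ Fintype.card I := by
      simp_rw [← hbc]
      rw [Finset.sum_comm]
      simp_rw [hbr]
      refine (Finset.sum_le_sum fun i _ => hr i).trans ?_
      simp
    exact_mod_cast this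
  obtain ⟨g, hg, hgc⟩ := frac_assign (T := Option T)
    (fun i o => o.elim (1 - ∑ t, b i t) (b i)) (fun o => o.elim (Fintype.card I - ∑ t, c t) c)
    (by
      rintro i (_ | t)
      · simp only [Option.elim]; rw [hbr]; linarith [hr i]
      · exact hb0 i t)
    (by intro i; rw [Fintype.sum_option]; simp)
    (by
      rintro (_ | t)
      · simp only [Option.elim]
        rw [Nat.cast_sub hle, Finset.sum_sub_distrib, Finset.sum_comm]
        simp_rw [hbc]
        simp
      · exact hbc t)
  have hex : ∀ i, ∃ o : Option E, (∀ e, o = some e → cls e = i ∧ w (s e) ≠ 0) ∧ g i = o.map s := by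
    intro i
    have := hg i
    rcases h : g i with _ | t
    · exact ⟨none, by simp⟩
    · rw [h] at this
      obtain ⟨e, he, hne⟩ := Finset.exists_ne_zero_of_sum_ne_zero this
      simp only [mem_filter, mem_univ, true_and] at he
      refine ⟨some e, ?_, by simp [he.2]⟩
      rintro e' ⟨⟩
      exact ⟨he.1, hne⟩
  choose o ho hgo using hex
  refine ⟨univ.filter (fun e => o (cls e) = some e), ?_, ?_, ?_, ?_⟩
  · intro e he e' he' h
    simp only [mem_filter, mem_univ, true_and] at he he'
    rw [h, he'] at he
    exact (Option.some.inj he).symm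
  · intro t
    have := hgc (some t)
    simp only [Option.elim] at this
    rw [← this]
    apply Finset.card_bij (fun e _ => cls e)
    · intro e he
      simp only [mem_filter, mem_univ, true_and] at he ⊢
      rw [hgo, he.1]; simp [he.2]
    · intro e he e' he' h
      simp only [mem_filter, mem_univ, true_and] at he he'
      rw [h, he'.1] at he
      exact (Option.some.inj he.1).symm
    · intro i hi
      simp only [mem_filter, mem_univ, true_and] at hi
      rw [hgo, Option.map_eq_some_iff] at hi
      obtain ⟨e, he, hs⟩ := hi
      have := (ho i e he).1
      refine ⟨e, ?_, this⟩
      simp [this, he, hs]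
  · intro e he
    simp only [mem_filter, mem_univ, true_and] at he
    exact (ho _ e he).2
  · intro i hi
    rcases h : o i with _ | e
    · exfalso
      have h2 := hg i
      rw [hgo, h] at h2
      simp only [Option.map_none, Option.elim] at h2
      rw [hbr, hi] at h2
      simp at h2
    · have := (ho i e h).1
      exact ⟨e, by simp [this, h], this⟩

open Finset in
theorem baranyai_step {E I V : Type} [Fintype E] [Fintype I] [Fintype V] [DecidableEq I]
    [DecidableEq V] [DecidableEq E] (u : ℕ) (cls : E → I) (A : Finset V) (n : ℕ)
    (s : E → Finset V) (a : V) (ha : a ∉ A)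
    (h1 : ∀ e, s e ⊆ A) (h2 : ∀ e, (s e).card ≤ u)
    (h3 : ∀ S ⊆ A, S.card ≤ u → (univ.filter (fun e => s e = S)).card = (n+1).choose (u - S.card))
    (h4 : ∀ e e', e ≠ e' → cls e = cls e' → Disjoint (s e) (s e'))
    (h5 : ∀ i, ∑ e with cls e = i, (u - (s e).card) ≤ n + 1) :
    ∃ s' : E → Finset V, 
    (∀ e, s' e ⊆ insert a A) ∧ (∀ e, (s' e).card ≤ u) ∧
    (∀ S ⊆ insert a A, S.card ≤ u →
      (univ.filter (fun e => s' e = S)).card = n.choose (u - S.card)) ∧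
    (∀ e e', e ≠ e' → cls e = cls e' → Disjoint (s' e) (s' e')) ∧
    (∀ i, ∑ e with cls e = i, (u - (s' e).card) ≤ n) := by
  have hsum : ∀ i, ∑ e with cls e = i, (((u - (s e).card : ℕ) : ℚ) / (n+1)) =
      ((∑ e with cls e = i, (u - (s e).card) : ℕ) : ℚ) / (n+1) := by
    intro i; push_cast; rw [Finset.sum_div]
  have hn : (0:ℚ) < n + 1 := by positivity
  obtain ⟨X, hX1, hX2, hX3, hX4⟩ := frac_pick cls s (fun S => ((u - S.card : ℕ) : ℚ) / (n+1))
    (fun S => if S ⊆ A ∧ S.card < u then n.choose (u - S.card - 1) else 0)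
    (fun t => by positivity)
    (by
      intro S
      rw [Finset.sum_congr rfl (g := fun _ => ((u - S.card : ℕ) : ℚ) / (n+1))
        (by intro e he; rw [(mem_filter.1 he).2])]
      rw [sum_const, nsmul_eq_mul]
      split_ifs with h
      · rw [h3 S h.1 h.2.le]
        obtain ⟨r, hr⟩ : ∃ r, u - S.card = r + 1 := ⟨u - S.card - 1, by omega⟩
        rw [hr, ← mul_div_assoc, div_eq_iff hn.ne']
        have := Nat.add_one_mul_choose_eq n r
        simp only [Nat.add_sub_cancel]
        rw [mul_comm (n.choose r : ℚ)]
        exact_mod_cast this.symm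
      · by_cases hS : S ⊆ A
        · have : u - S.card = 0 := by
            have : ¬ S.card < u := fun h' => h ⟨hS, h'⟩
            omega
          simp [this]
        · have : (univ.filter (fun e => s e = S)) = ∅ := by
            apply filter_eq_empty_iff.2
            rintro e _ rfl
            exact hS (h1 e)
          simp [this])
    (by
      intro i
      rw [hsum, div_le_one hn]
      exact_mod_cast h5 i)
  have haS : ∀ e, a ∉ s e := fun e h => ha (h1 e h)
  have hlt : ∀ e ∈ X, (s e).card < u := by
    intro e he
    by_contra h
    apply hX3 e he
    have : u - (s e).card = 0 := by omega
    simp [this]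
  refine ⟨fun e => if e ∈ X then insert a (s e) else s e, ?_, ?_, ?_, ?_, ?_⟩
  · intro e
    dsimp only
    split_ifs
    · exact insert_subset_insert _ (h1 e)
    · exact (h1 e).trans (subset_insert _ _)
  · intro e
    dsimp only
    split_ifs with h
    · rw [card_insert_of_notMem (haS e)]; exact hlt e h
    · exact h2 e
  · intro S hS hSu
    by_cases haS' : a ∈ S
    · have hE : (S.erase a) ⊆ A := by
        intro x hx
        have := hS (mem_of_mem_erase hx)
        rcases mem_insert.1 this with h | h
        · exact absurd h (ne_of_mem_erase hx)
        · exact h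
      have hcE : (S.erase a).card + 1 = S.card := card_erase_add_one haS'
      have := hX2 (S.erase a)
      rw [if_pos ⟨hE, by omega⟩] at this
      rw [show u - S.card = u - (S.erase a).card - 1 by omega, ← this]
      congr 1
      ext e
      simp only [mem_filter, mem_univ, true_and]
      split_ifs with h
      · simp only [h, true_and]
        constructor
        · rintro rfl
          rw [erase_insert (haS e)]
        · intro h'
          rw [h', insert_erase haS']
      · simp only [h, false_and, iff_false]
        rintro rfl
        exact haS e haS'
    · have hSA : S ⊆ A := by
        intro x hx
        rcases mem_insert.1 (hS hx) with h | h
        · subst h; exact absurd hx haS'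
        · exact h
      have hx := hX2 S
      have h3' := h3 S hSA hSu
      have e1 : (univ.filter (fun e => (if e ∈ X then insert a (s e) else s e) = S)) =
        (univ.filter (fun e => s e = S)) \ (X.filter (fun e => s e = S)) := by
        ext e
        simp only [mem_filter, mem_univ, true_and, mem_sdiff]
        split_ifs with h
        · simp only [h, true_and, and_not_self, iff_false]
          rintro rfl
          exact haS' (mem_insert_self _ _)
        · simp [h]
      rw [e1, card_sdiff_of_subset (filter_subset_filter _ (subset_univ _)), h3', hx]
      by_cases hu : S.card < u
      · rw [if_pos ⟨hSA, hu⟩]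
        obtain ⟨r, hr⟩ : ∃ r, u - S.card = r + 1 := ⟨u - S.card - 1, by omega⟩
        rw [hr, Nat.choose_succ_succ]
        simp
      · have : u - S.card = 0 := by omega
        rw [if_neg (fun h => hu h.2), this]
        simp
  · intro e e' hne hcl
    have hd := h4 e e' hne hcl
    dsimp only
    split_ifs with h h' h'
    · exact absurd (hX1 e h e' h' hcl) hne
    · rw [disjoint_insert_left]; exact ⟨haS e', hd⟩
    · rw [disjoint_insert_right]; exact ⟨haS e, hd⟩
    · exact hd
  · intro i
    beta_reduce
    have hle : ∀ e ∈ univ.filter (fun e => cls e = i),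
        u - (if e ∈ X then insert a (s e) else s e).card ≤ u - (s e).card := by
      intro e _
      split_ifs
      · rw [card_insert_of_notMem (haS e)]; omega
      · rfl
    by_cases h : ∑ e with cls e = i, (u - (s e).card) = n + 1
    · obtain ⟨e, he, hei⟩ := hX4 i (by
        rw [hsum, h]; push_cast; exact div_self hn.ne')
      have := Finset.sum_lt_sum hle ⟨e, by simp [hei], by
        rw [if_pos he, card_insert_of_notMem (haS e)]
        have := hlt e he
        omega⟩
      omega
    · have := Finset.sum_le_sum hle
      have := h5 i
      omega

open Finset in
theorem baranyai_ind {E I V : Type} [Fintype E] [Fintype I] [Fintype V] [DecidableEq I]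
    [DecidableEq V] [DecidableEq E] (u : ℕ) (cls : E → I)
    (hE : Fintype.card E = (Fintype.card V).choose u)
    (hcls : ∀ i, (univ.filter (fun e => cls e = i)).card * u ≤ Fintype.card V)
    (A : Finset V) : ∃ s : E → Finset V, 
    (∀ e, s e ⊆ A) ∧ (∀ e, (s e).card ≤ u) ∧
    (∀ S ⊆ A, S.card ≤ u →
      (univ.filter (fun e => s e = S)).card = (Aᶜ.card).choose (u - S.card)) ∧
    (∀ e e', e ≠ e' → cls e = cls e' → Disjoint (s e) (s e')) ∧
    (∀ i, ∑ e with cls e = i, (u - (s e).card) ≤ Aᶜ.card) := by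
  induction A using Finset.induction_on with
  | empty =>
    refine ⟨fun _ => ∅, by simp, by simp, ?_, by simp, by simpa using hcls⟩
    intro S hS _
    have := subset_empty.1 hS
    subst this
    simp [hE]
  | insert a A ha ih =>
    obtain ⟨s, h1, h2, h3, h4, h5⟩ := ih
    have hc : Aᶜ.card = (insert a A)ᶜ.card + 1 := by
      have h1 := card_compl_add_card A
      have h2 := card_compl_add_card (insert a A)
      rw [card_insert_of_notMem ha] at h2
      omega
    rw [hc] at h3 h5
    exact baranyai_step u cls A _ s a ha h1 h2 h3 h4 h5

open Finset in
theorem stmt7 (N u v α β : ℕ) (hu : 0 < u) (hv : 0 < v) (huv : u * v ≤ N)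
    (hβ : β < v) (hchoose : N.choose u = α * v + β) :
    ∃ P : ℕ → Finset (Finset (Fin N)),
      (∀ i, ∀ S ∈ P i, S.card = u) ∧
      (∀ i, ∀ S ∈ P i, ∀ T ∈ P i, S ≠ T → Disjoint S T) ∧
      (∀ S : Finset (Fin N), S.card = u → ∃! i, i ≤ α ∧ S ∈ P i) ∧
      (∀ i < α, (P i).card = v) ∧
      (P α).card = β := by
  let m : Fin (α + 1) → ℕ := fun i => if i.1 < α then v else β
  let cls : (Σ i, Fin (m i)) → Fin (α + 1) := fun e => e.1
  have hf : ∀ i, (univ.filter (fun e => cls e = i)).card = m i := by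
    intro i
    have : univ.filter (fun e => cls e = i) =
        (univ : Finset (Fin (m i))).image (fun k => (⟨i, k⟩ : Σ i, Fin (m i))) := by
      ext ⟨j, k⟩
      simp only [mem_filter, mem_univ, true_and, mem_image, cls]
      constructor
      · rintro rfl; exact ⟨k, rfl⟩
      · rintro ⟨k', h⟩; exact (congrArg Sigma.fst h).symm
    rw [this, card_image_of_injective _ sigma_mk_injective]
    simp
  have hm : ∀ i, m i ≤ v := by
    intro i; dsimp only [m]; split_ifs <;> omega
  obtain ⟨s, -, h2, h3, h4, -⟩ := baranyai_ind (V := Fin N) u cls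
    (by
      simp only [Fintype.card_sigma, Fintype.card_fin, m]
      rw [Fin.sum_univ_castSucc, hchoose]
      simp)
    (by
      intro i
      rw [hf, Fintype.card_fin]
      calc m i * u ≤ v * u := Nat.mul_le_mul_right _ (hm i)
        _ ≤ N := by rw [mul_comm]; exact huv) univ
  simp only [compl_univ, card_empty] at h3
  have hsu : ∀ e, (s e).card = u := by
    intro e
    by_contra hne
    have := h2 e
    have h := h3 (s e) (subset_univ _) (h2 e)
    rw [Nat.choose_eq_zero_of_lt (by omega), card_eq_zero] at h
    have : e ∈ univ.filter (fun e' => s e' = s e) := by simp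
    rw [h] at this
    simp at this
  have hone : ∀ S : Finset (Fin N), S.card = u → ∃ e, univ.filter (fun e => s e = S) = {e} := by
    intro S hS
    have h := h3 S (subset_univ _) hS.le
    rw [hS, Nat.sub_self, Nat.choose_self] at h
    exact card_eq_one.1 h
  have hinj : Function.Injective s := by
    intro e e' h
    obtain ⟨x, hx⟩ := hone (s e) (hsu e)
    have a1 : e ∈ univ.filter (fun e' => s e' = s e) := by simp
    have a2 : e' ∈ univ.filter (fun e' => s e' = s e) := by simp [h]
    rw [hx, mem_singleton] at a1 a2
    rw [a1, a2]
  let P : ℕ → Finset (Finset (Fin N)) := fun i => (univ.filter (fun e => (cls e).1 = i)).image s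
  have hP : ∀ i S, S ∈ P i ↔ ∃ e, (cls e).1 = i ∧ s e = S := by
    intro i S; simp only [P, mem_image, mem_filter, mem_univ, true_and]
  have hcard : ∀ i : Fin (α + 1), (P i.1).card = m i := by
    intro i
    rw [← hf i]
    simp only [P]
    rw [card_image_of_injective _ hinj]
    simp only [Fin.ext_iff]
  refine ⟨P, ?_, ?_, ?_, ?_, ?_⟩
  · intro i S hS
    obtain ⟨e, -, rfl⟩ := (hP _ _).1 hS
    exact hsu e
  · intro i S hS T hT hne
    obtain ⟨e, he, rfl⟩ := (hP _ _).1 hS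
    obtain ⟨e', he', rfl⟩ := (hP _ _).1 hT
    exact h4 e e' (fun h => hne (by rw [h])) (Fin.ext (he.trans he'.symm))
  · intro S hS
    obtain ⟨e, he⟩ := hone S hS
    have hes : s e = S := by
      have : e ∈ univ.filter (fun e => s e = S) := by rw [he]; simp
      simpa using this
    refine ⟨(cls e).1, ⟨Nat.lt_succ_iff.1 (cls e).2, (hP _ _).2 ⟨e, rfl, hes⟩⟩, ?_⟩
    rintro i ⟨_, hi⟩
    obtain ⟨e', he', hs'⟩ := (hP _ _).1 hi
    rw [← he', hinj (hs'.trans hes.symm)]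
  · intro i hi
    have := hcard ⟨i, by omega⟩
    simpa [m, hi] using this
  · have := hcard ⟨α, by omega⟩
    simpa [m] using this
end

section
/- Let N and v be integers with 3 ≤ v < N. Then the v-type 𝓛(N,v) is admissible for ground-set size N: for every 0 ≤ x ≤ N, the total number of entries equal to x over all shapes of 𝓛(N,v), counted with multiplicity, is at most the binomial coefficient C(N,x). -/
/-- `L_i(N,v)`: the `v`-shape (multiset of `v` nonnegative integers summing to `N`)
whose smallest entry equals `i` and whose remaining `v−1` entries pairwise differ by at
most `1`; these remaining entries are the balanced split of `N − i` into `v − 1` parts.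
(For the indices `i` at which the paper uses `L_i`, this is exactly the unique such
shape.) -/
def Lshape (N v i : ℕ) : Multiset ℕ :=
  i ::ₘ (Multiset.replicate ((N - i) % (v - 1)) ((N - i) / (v - 1) + 1)
    + Multiset.replicate ((v - 1) - (N - i) % (v - 1)) ((N - i) / (v - 1)))

/-- `L_*(N,v)` (for `N ≡ v−1 (mod v)`, `f = ⌊(N+1)/v⌋`): the `v`-shape with two entries
equal to `f−1`, `v−3` entries equal to `f`, and one entry equal to `f+1`. -/
def Lstar (N v : ℕ) : Multiset ℕ :=
  let f := (N + 1) / v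
  Multiset.replicate 2 (f - 1) + Multiset.replicate (v - 3) f
    + Multiset.replicate 1 (f + 1)

/-- The type `𝓛(N,v)` of Definition 3.2: `C(N,i)` copies of `L_i(N,v)` for
`0 ≤ i ≤ f−2`, together with (if `N ≢ v−1 (mod v)`) `C(N,f−1)` copies of `L_{f−1}(N,v)`
and `⌊(C(N,f)−s)/d⌋` copies of `L_f(N,v)`, or (if `N ≡ v−1 (mod v)`)
`C(N,f−1) − 2⌈s'/(v+1)⌉` copies of `L_{f−1}(N,v)` and `⌈s'/(v+1)⌉` copies of
`L_*(N,v)`; here `s = Σ_{i=f−d+2}^{f−1} (d−f−1+i)·C(N,i)` and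
`s' = Σ_{i=f−v+1}^{f−2} (v−f+i)·C(N,i)` (terms with negative index vanish). -/
def LL (N v : ℕ) : Multiset (Multiset ℕ) :=
  let f := (N + 1) / v
  let d := (f + 1) * v - N
  let s := ∑ i ∈ Finset.Icc (f + 2 - d) (f - 1), (d + i - (f + 1)) * N.choose i
  let s' := ∑ i ∈ Finset.Icc (f + 1 - v) (f - 2), (v + i - f) * N.choose i
  (∑ i ∈ Finset.range (f - 1), Multiset.replicate (N.choose i) (Lshape N v i))
    + if N % v = v - 1 then
        Multiset.replicate (N.choose (f - 1) - 2 * ((s' + v) / (v + 1)))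
            (Lshape N v (f - 1))
          + Multiset.replicate ((s' + v) / (v + 1)) (Lstar N v)
      else
        Multiset.replicate (N.choose (f - 1)) (Lshape N v (f - 1))
          + Multiset.replicate ((N.choose f - s) / d) (Lshape N v f)

namespace LLaux

def hat (q m x : ℕ) : ℕ := min (m + q - x * q) ((x + 1) * q - m)

lemma hat_eq (q m x : ℕ) (hq : 0 < q) :
    hat q m x = (if x = m / q + 1 then m % q else 0) + (if x = m / q then q - m % q else 0) := by
  unfold hat
  have h1 := Nat.div_add_mod m q
  have h2 := Nat.mod_lt m hq
  generalize m / q = t at *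
  generalize m % q = e at *
  subst h1
  rw [Nat.add_mul, one_mul]
  rcases lt_trichotomy x t with h | h | h
  · have h3 : (x + 1) * q ≤ t * q := Nat.mul_le_mul_right q h
    rw [Nat.add_mul, one_mul] at h3
    rw [if_neg (by omega), if_neg (by omega), mul_comm q t]
    omega
  · subst h
    rw [if_neg (by omega), if_pos rfl, mul_comm q x]
    omega
  · rcases eq_or_lt_of_le (Nat.succ_le_of_lt h) with h' | h'
    · subst h'
      rw [if_pos rfl, if_neg (by omega), mul_comm q t]
      simp only [Nat.succ_eq_add_one, Nat.add_mul, one_mul]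
      omega
    · have h3 : (t + 2) * q ≤ x * q := Nat.mul_le_mul_right q h'
      rw [Nat.add_mul] at h3
      rw [if_neg (by omega), if_neg (by omega), mul_comm q t]
      omega

lemma count_L (N q i x : ℕ) (hq : 0 < q) :
    (Lshape N (q + 1) i).count x = (if x = i then 1 else 0) + hat q (N - i) x := by
  rw [hat_eq _ _ _ hq]
  simp only [Lshape, Nat.add_sub_cancel, Multiset.count_cons, Multiset.count_add,
    Multiset.count_replicate]
  simp only [eq_comm (b := x)]
  omega

lemma map_sum_aux (n : ℕ) (c : ℕ → ℕ) (M : ℕ → Multiset ℕ) (φ : Multiset ℕ → ℕ) :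
    ((∑ i ∈ Finset.range n, Multiset.replicate (c i) (M i)).map φ).sum
      = ∑ i ∈ Finset.range n, c i * φ (M i) := by
  induction n with
  | zero => simp
  | succ n ih => simp [Finset.sum_range_succ, ih]

lemma S_le (a : ℕ → ℕ) (q n : ℕ) (h : ∀ i < n, (q + 1) * a i ≤ a (i + 1)) :
    q * ∑ i ∈ Finset.range n, a i ≤ a n := by
  induction n with
  | zero => simp
  | succ n ih =>
    have := ih (fun i hi => h i (by omega))
    have := h n (by omega)
    rw [Finset.sum_range_succ]
    nlinarith

lemma T_le (a : ℕ → ℕ) (n : ℕ) (h : ∀ i < n, 2 * a i ≤ a (i + 1)) :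
    ∑ i ∈ Finset.range n, a i * (n - i - 1) ≤ a n := by
  induction n with
  | zero => simp
  | succ n ih =>
    have h1 := ih (fun i hi => h i (by omega))
    have h2 := h n (by omega)
    have h3 := S_le a 1 n (fun i hi => h i (by omega))
    rw [Finset.sum_range_succ]
    have : ∑ i ∈ Finset.range n, a i * (n + 1 - i - 1)
      = ∑ i ∈ Finset.range n, a i * (n - i - 1) + ∑ i ∈ Finset.range n, a i := by
      rw [← Finset.sum_add_distrib]
      refine Finset.sum_congr rfl fun i hi => ?_
      have := Finset.mem_range.1 hi
      rw [show n + 1 - i - 1 = (n - i - 1) + 1 by omega]; ring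
    rw [this]
    simp
    omega

lemma ratio (N q f : ℕ) (hN : f * (q + 1) ≤ N + 1) :
    ∀ i < f, q * N.choose i ≤ N.choose (i + 1) := by
  intro i hi
  have h := Nat.choose_succ_right_eq N i
  have h1 : (i + 1) * (q + 1) ≤ f * (q + 1) := Nat.mul_le_mul_right _ hi
  have h2 : (i + 1) * q ≤ N - i := by
    have : (i + 1) * (q + 1) = (i + 1) * q + (i + 1) := by ring
    omega
  have h3 : N.choose i * ((i + 1) * q) ≤ N.choose i * (N - i) := Nat.mul_le_mul_left _ h2
  have : (i + 1) * (q * N.choose i) ≤ (i + 1) * N.choose (i + 1) := by nlinarith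
  exact Nat.le_of_mul_le_mul_left this (by omega)

lemma choose_mono (N f x : ℕ) (hx : x ≤ N / 2) (hf : f ≤ x) : N.choose f ≤ N.choose x := by
  induction x, hf using Nat.le_induction with
  | base => rfl
  | succ n hn ih =>
    exact (ih (by omega)).trans (Nat.choose_le_succ_of_lt_half_left (by omega))

lemma choose_mono' (N f x : ℕ) (hx : 2 * x ≤ N + 1) (hf : f < x) : N.choose f ≤ N.choose x := by
  by_cases h : x ≤ N / 2
  · exact choose_mono N f x h hf.le
  · rw [← Nat.choose_symm (by omega : x ≤ N)]
    exact choose_mono N f _ (by omega) (by omega)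

lemma high (N q f x n : ℕ) (hq : 2 ≤ q) (hN : f * (q + 1) ≤ N + 1) (hN2 : N < f * (q + 1) + q)
    (hx : f + 2 ≤ x) (hn : n ≤ f) :
    ∑ i ∈ Finset.range n, N.choose i * hat q (N - i) x ≤ N.choose x := by
  by_cases h : 2 * x ≤ N + 1
  · refine le_trans ?_ (choose_mono' N f x h (by omega))
    refine le_trans ?_ (T_le (fun i => N.choose i) f (fun i hi =>
      (Nat.mul_le_mul_right _ hq).trans (ratio N q f hN i hi)))
    refine (Finset.sum_le_sum_of_subset (Finset.range_mono hn)).trans ?_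
    refine Finset.sum_le_sum fun i hi => Nat.mul_le_mul_left _ ?_
    have := Finset.mem_range.1 hi
    refine (min_le_left _ _).trans ?_
    have h1 : (f + 2) * q ≤ x * q := Nat.mul_le_mul_right _ hx
    rw [Nat.add_mul] at h1
    rw [Nat.mul_add] at hN2
    omega
  · rw [Finset.sum_eq_zero]
    · omega
    · intro i hi
      rw [mul_eq_zero]; right
      unfold hat
      have h1 : (x - 1) * 2 ≤ (x - 1) * q := Nat.mul_le_mul_left _ hq
      have h2 : x * q = (x - 1) * q + q := by
        obtain ⟨y, rfl⟩ : ∃ y, x = y + 1 := ⟨x - 1, by omega⟩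
        simp; ring
      omega

lemma low (N q f x i : ℕ) (hN : f * q ≤ N - i) (hx : x < f) : hat q (N - i) x = 0 := by
  have h1 : (x + 1) * q ≤ f * q := Nat.mul_le_mul_right _ hx
  unfold hat
  omega

lemma sum_ind (a : ℕ → ℕ) (n x : ℕ) :
    ∑ i ∈ Finset.range n, a i * (if x = i then 1 else 0) = if x < n then a x else 0 := by
  simp

lemma hat_le (q m x : ℕ) : hat q m x ≤ q := by
  unfold hat
  rw [Nat.add_mul]
  omega

lemma caseA (N q f r : ℕ) (hq : 2 ≤ q) (hf : 1 ≤ f) (hr : r + 1 ≤ q) (hN : N = f * (q + 1) + r)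
    (x F s : ℕ) (hs : s = ∑ i ∈ Finset.range f, N.choose i * hat q (N - i) f)
    (hF : F = (N.choose f - s) / (q + 1 - r)) :
    ∑ i ∈ Finset.range f, N.choose i * ((if x = i then 1 else 0) + hat q (N - i) x)
      + F * ((if x = f then 1 else 0) + hat q (N - f) x) ≤ N.choose x := by
  have hrat := ratio N q f (by omega)
  have hNe : N = f * q + f + r := by rw [hN]; ring
  simp only [Nat.mul_add, Finset.sum_add_distrib, sum_ind]
  have hFd : F * (q + 1 - r) ≤ N.choose f - s := hF ▸ Nat.div_mul_le_self _ _
  have hF2 : 2 * F ≤ N.choose f := by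
    have : F * 2 ≤ F * (q + 1 - r) := Nat.mul_le_mul_left _ (by omega)
    omega
  rcases lt_trichotomy x f with h | h | h
  · rw [if_pos h, if_neg (by omega), low N q f x f (by omega) h, Finset.sum_eq_zero]
    · simp
    · intro i hi
      have := Finset.mem_range.1 hi
      rw [low N q f x i (by omega) h]; simp
  · subst h
    rw [if_neg (by omega), if_pos rfl, ← hs]
    have hh : hat q (N - x) x = q - r := by
      unfold hat; rw [Nat.add_mul]; omega
    rw [hh]
    have hsA : s ≤ N.choose x := by
      obtain ⟨p, rfl⟩ : ∃ p, q = p + 1 := ⟨q - 1, by omega⟩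
      refine le_trans ?_ (S_le (fun i => N.choose i) p x hrat)
      rw [hs, Finset.mul_sum]
      refine Finset.sum_le_sum fun i hi => ?_
      rw [mul_comm]
      refine Nat.mul_le_mul_right _ ?_
      have := Finset.mem_range.1 hi
      refine (min_le_right _ _).trans ?_
      rw [Nat.add_mul x 1]; omega
    have : F * (q + 1 - r) = F * 1 + F * (q - r) := by
      rw [← Nat.mul_add]; congr 1; omega
    omega
  · rw [if_neg (by omega), if_neg (by omega)]
    rcases eq_or_lt_of_le (Nat.succ_le_of_lt h) with h' | h'
    · subst h'
      simp only [Nat.succ_eq_add_one]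
      have hh : hat q (N - f) (f + 1) = r := by
        unfold hat; simp only [Nat.add_mul]; omega
      rw [hh]
      have hB := Nat.choose_succ_right_eq N f
      rw [show N - f = f * q + r by omega] at hB
      rcases eq_or_lt_of_le hq with h2 | h3
      · subst h2
        have hA1 : N.choose f * f = N.choose (f - 1) * (2 * f + r + 1) := by
          have := Nat.choose_succ_right_eq N (f - 1)
          rw [show f - 1 + 1 = f by omega, show N - (f - 1) = 2 * f + r + 1 by omega] at this
          exact this
        have hr2 : r = 0 ∨ r = 1 := by omega
        obtain ⟨g, rfl⟩ : ∃ g, f = g + 1 := ⟨f - 1, by omega⟩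
        rcases Nat.eq_zero_or_pos g with hg | hg
        · subst hg
          have e0 : hat 2 N (0 + 1 + 1) = r + 1 := by unfold hat; omega
          simp [e0]
          rcases hr2 with rfl | rfl <;> simp at hN <;> subst hN <;> simp at hF2 hB ⊢ <;>
            norm_num [Nat.choose] at hF2 ⊢
          omega
        obtain ⟨k, rfl⟩ : ∃ k, g = k + 1 := ⟨g - 1, by omega⟩
        rw [Finset.sum_range_succ, Finset.sum_range_succ]
        have r1 := hrat (k + 1) (by omega)
        have r2 := hrat k (by omega)
        have hS := S_le (fun i => N.choose i) 1 k (fun i hi => hrat i (by omega))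
        simp only [one_mul] at hS
        have e1 : hat 2 (N - (k + 1)) (k + 1 + 1 + 1) = r + 1 := by
          unfold hat; omega
        have e2 : hat 2 (N - k) (k + 1 + 1 + 1) = 2 - r := by
          unfold hat; omega
        have e3 : ∑ i ∈ Finset.range k, N.choose i * hat 2 (N - i) (k + 1 + 1 + 1)
            ≤ (1 - r) * ∑ i ∈ Finset.range k, N.choose i := by
          rw [Finset.mul_sum]
          refine Finset.sum_le_sum fun i hi => ?_
          rw [mul_comm]
          refine Nat.mul_le_mul_right _ ?_
          have := Finset.mem_range.1 hi
          refine (min_le_right _ _).trans ?_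
          omega
        rw [e1, e2]
        simp only [Nat.add_sub_cancel] at hA1
        generalize N.choose (k + 1 + 1 + 1) = B at *
        generalize N.choose (k + 1 + 1) = A at *
        generalize N.choose (k + 1) = A1 at *
        generalize N.choose k = A2 at *
        generalize ∑ i ∈ Finset.range k, N.choose i = S at *
        generalize ∑ i ∈ Finset.range k, N.choose i * hat 2 (N - i) (k + 1 + 1 + 1) = S2 at *
        rcases hr2 with rfl | rfl
        · -- 3B ≥ 4A
          have : 4 * A ≤ 3 * B := by
            have : (k + 3) * (4 * A) ≤ (k + 3) * (3 * B) := by nlinarith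
            exact Nat.le_of_mul_le_mul_left this (by omega)
          omega
        · simp at e3 ⊢
          have h5 : 2 * A1 + A ≤ B := by
            have : (k + 3) * (2 * A1 + A) ≤ (k + 3) * B := by nlinarith
            exact Nat.le_of_mul_le_mul_left this (by omega)
          omega
      · have hS := S_le (fun i => N.choose i) 2 f (fun i hi =>
          (Nat.mul_le_mul_right _ h3).trans (hrat i hi))
        have hH : ∑ i ∈ Finset.range f, N.choose i * hat q (N - i) (f + 1)
            ≤ q * ∑ i ∈ Finset.range f, N.choose i := by
          rw [Finset.mul_sum]
          refine Finset.sum_le_sum fun i hi => ?_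
          rw [mul_comm]
          exact Nat.mul_le_mul_right _ (hat_le _ _ _)
        beta_reduce at hS
        generalize N.choose (f + 1) = B at *
        generalize N.choose f = A at *
        generalize ∑ i ∈ Finset.range f, N.choose i = S at *
        have h5 : (q + r) * A ≤ 2 * B := by
          have h6 : (f + 1) * (q + r) ≤ 2 * (f * q + r) := by
            obtain ⟨g, rfl⟩ : ∃ g, f = g + 1 := ⟨f - 1, by omega⟩
            have : g * r ≤ g * q := Nat.mul_le_mul_left _ (by omega)
            nlinarith
          have : (f + 1) * ((q + r) * A) ≤ (f + 1) * (2 * B) := by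
            have := Nat.mul_le_mul_right A h6
            nlinarith
          exact Nat.le_of_mul_le_mul_left this (by omega)
        have h7 : q * (2 * S) ≤ q * A := Nat.mul_le_mul_left _ hS
        have h8 : r * (2 * F) ≤ r * A := Nat.mul_le_mul_left _ hF2
        nlinarith
    · have e : hat q (N - f) x = 0 := by
        unfold hat
        have h1 : (f + 2) * q ≤ x * q := Nat.mul_le_mul_right _ h'
        rw [Nat.add_mul] at h1
        omega
      have := high N q f x f hq (by omega) (by omega) h' le_rfl
      rw [e]; omega

lemma caseB (N q f : ℕ) (hq : 2 ≤ q) (hf : 2 ≤ f) (hN : N + 1 = f * (q + 1))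
    (x m s : ℕ) (hs : s = ∑ i ∈ Finset.range (f - 1), N.choose i * hat q (N - i) f)
    (hm : m = (s + (q + 1)) / (q + 1 + 1)) :
    ∑ i ∈ Finset.range (f - 1), N.choose i * ((if x = i then 1 else 0) + hat q (N - i) x)
      + ((N.choose (f - 1) - 2 * m) * ((if x = f - 1 then 1 else 0) + hat q (N - (f - 1)) x)
      + m * ((if x = f - 1 then 2 else 0) + (if x = f then q - 2 else 0)
        + (if x = f + 1 then 1 else 0))) ≤ N.choose x := by
  have hrat := ratio N q f (by omega)
  have hNe : N + 1 = f * q + f := by rw [hN]; ring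
  have hfq : f * 2 ≤ f * q := Nat.mul_le_mul_left _ hq
  simp only [Nat.mul_add, Finset.sum_add_distrib, sum_ind]
  have hsA : s ≤ N.choose (f - 1) := by
    obtain ⟨p, rfl⟩ : ∃ p, q = p + 1 := ⟨q - 1, by omega⟩
    refine le_trans ?_ (S_le (fun i => N.choose i) p (f - 1) (fun i hi => hrat i (by omega)))
    rw [hs, Finset.mul_sum]
    refine Finset.sum_le_sum fun i hi => ?_
    rw [mul_comm]
    refine Nat.mul_le_mul_right _ ?_
    have := Finset.mem_range.1 hi
    refine (min_le_right _ _).trans ?_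
    rw [Nat.add_mul f 1]; omega
  have ha : 5 ≤ N.choose (f - 1) := by
    have := choose_mono N 1 (f - 1) (by omega) (by omega)
    rw [Nat.choose_one_right] at this
    omega
  have hm1 : (q + 2) * m ≤ s + (q + 1) := by
    rw [hm]; exact Nat.mul_div_le _ _
  have hm3 : s ≤ (q + 2) * m := by
    have := Nat.lt_div_mul_add (a := s + (q + 1)) (b := q + 1 + 1) (by omega)
    rw [← hm] at this
    have e : m * (q + 1 + 1) = (q + 2) * m := by ring
    omega
  have hm2 : 2 * m ≤ N.choose (f - 1) := by
    -- m ≤ ceil (s/4)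
    have : 4 * m ≤ s + 3 := by
      by_cases h0 : m = 0
      · omega
      · obtain ⟨k, rfl⟩ : ∃ k, m = k + 1 := ⟨m - 1, by omega⟩
        obtain ⟨p, rfl⟩ : ∃ p, q = p + 2 := ⟨q - 2, by omega⟩
        nlinarith [Nat.zero_le (p * k)]
    omega
  have hA : N.choose f = q * N.choose (f - 1) := by
    have := Nat.choose_succ_right_eq N (f - 1)
    rw [show f - 1 + 1 = f by omega, show N - (f - 1) = f * q by omega] at this
    have h2 : f * N.choose f = f * (q * N.choose (f - 1)) := by rw [mul_comm, this]; ring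
    exact Nat.eq_of_mul_eq_mul_left (by omega) h2
  rcases lt_trichotomy x f with h | h | h
  · rw [low N q f x (f - 1) (by omega) h, Finset.sum_eq_zero (s := Finset.range (f - 1))
      (f := fun i => N.choose i * hat q (N - i) x)]
    · rw [if_neg (by omega : x ≠ f), if_neg (by omega : x ≠ f + 1)]
      by_cases h1 : x = f - 1
      · subst h1; simp; omega
      · rw [if_pos (by omega), if_neg h1, if_neg h1]; simp
    · intro i hi
      have := Finset.mem_range.1 hi
      rw [low N q f x i (by omega) h]; simp
  · subst h
    rw [if_neg (by omega), if_neg (by omega), if_neg (by omega), if_pos rfl, if_neg (by omega),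
      ← hs]
    have hh : hat q (N - (x - 1)) x = q := by
      unfold hat; rw [Nat.add_mul]; omega
    rw [hh, hA]
    generalize N.choose (x - 1) = a at *
    obtain ⟨b, rfl⟩ : ∃ b, a = b + 2 * m := ⟨a - 2 * m, by omega⟩
    obtain ⟨p, rfl⟩ : ∃ p, q = p + 2 := ⟨q - 2, by omega⟩
    simp only [Nat.add_sub_cancel]
    nlinarith
  · rw [if_neg (by omega), if_neg (by omega), if_neg (by omega), if_neg (by omega)]
    have e : hat q (N - (f - 1)) x = 0 := by
      unfold hat
      have h1 : (f + 1) * q ≤ x * q := Nat.mul_le_mul_right _ h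
      rw [Nat.add_mul] at h1
      omega
    rw [e]
    rcases eq_or_lt_of_le (Nat.succ_le_of_lt h) with h' | h'
    · subst h'
      simp only [Nat.succ_eq_add_one, if_true]
      have hB := Nat.choose_succ_right_eq N f
      have hNf : N - f = f * q - 1 := by omega
      rw [hNf] at hB
      have hT := T_le (fun i => N.choose i) f (fun i hi =>
        (Nat.mul_le_mul_right _ hq).trans (hrat i hi))
      have hH : ∑ i ∈ Finset.range (f - 1), N.choose i * hat q (N - i) (f + 1) ≤
          ∑ i ∈ Finset.range (f - 1), N.choose i * (f - i - 1) := by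
        refine Finset.sum_le_sum fun i hi => Nat.mul_le_mul_left _ ?_
        have := Finset.mem_range.1 hi
        refine (min_le_left _ _).trans ?_
        rw [Nat.add_mul]
        omega
      have hq2 : 2 * N.choose (f - 1) ≤ N.choose f := by
        rw [hA]; exact Nat.mul_le_mul_right _ hq
      rcases eq_or_lt_of_le hf with h2 | h3
      · subst h2
        simp at hH hq2 hm2 ha ⊢
        have : N.choose 2 ≤ N.choose 3 := by
          have : 3 * N.choose 2 ≤ 3 * N.choose 3 := by
            have : N.choose 2 * 3 ≤ N.choose 2 * (2 * q - 1) := Nat.mul_le_mul_left _ (by omega)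
            simp only [Nat.reduceAdd] at hB
            omega
          omega
        omega
      · have h5 : 5 * N.choose f ≤ 4 * N.choose (f + 1) := by
          have h6 : 5 * (f + 1) ≤ 4 * (f * q - 1) := by omega
          have := Nat.mul_le_mul_left (N.choose f) h6
          have : (f + 1) * (5 * N.choose f) ≤ (f + 1) * (4 * N.choose (f + 1)) := by nlinarith
          exact Nat.le_of_mul_le_mul_left this (by omega)
        have h7 := Finset.sum_le_sum_of_subset (f := fun i => N.choose i * (f - i - 1))
          (Finset.range_mono (by omega : f - 1 ≤ f))
        beta_reduce at hT h7
        simp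
        omega
    · have := high N q f x (f - 1) hq (by omega) (by omega) h' (by omega)
      simp only [Nat.succ_eq_add_one] at h'
      rw [if_neg (by omega)]
      simpa using this

end LLaux

open LLaux in
theorem stmt17 (N v : ℕ) (hv : 3 ≤ v) (hvN : v < N) :
    ∀ x ≤ N, ((LL N v).map fun M => M.count x).sum ≤ N.choose x := by
  intro x _
  obtain ⟨q, rfl⟩ : ∃ q, v = q + 1 := ⟨v - 1, by omega⟩
  unfold LL
  simp only [Multiset.map_add, Multiset.sum_add, map_sum_aux, count_L N q _ x (by omega)]
  by_cases hc : N % (q + 1) = q + 1 - 1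
  · rw [if_pos hc]
    have hN : N + 1 = (N + 1) / (q + 1) * (q + 1) := by
      refine (Nat.div_mul_cancel ?_).symm
      have := Nat.div_add_mod N (q + 1)
      exact ⟨N / (q + 1) + 1, by rw [mul_add]; omega⟩
    have hf : 2 ≤ (N + 1) / (q + 1) := by
      by_contra hlt
      have : (N + 1) / (q + 1) * (q + 1) ≤ 1 * (q + 1) := Nat.mul_le_mul_right _ (by omega)
      omega
    have hls : (Lstar N (q + 1)).count x = (if x = (N + 1) / (q + 1) - 1 then 2 else 0)
        + (if x = (N + 1) / (q + 1) then q - 2 else 0)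
        + (if x = (N + 1) / (q + 1) + 1 then 1 else 0) := by
      simp only [Lstar, Multiset.count_add, Multiset.count_replicate]
      simp only [eq_comm (b := x)]
      rfl
    simp only [Multiset.map_add, Multiset.sum_add, Multiset.map_replicate,
      Multiset.sum_replicate, smul_eq_mul, count_L N q _ x (by omega), hls]
    generalize (N + 1) / (q + 1) = f at *
    have hNe : N + 1 = f * q + f := by rw [hN]; ring
    have hfq : f * 2 ≤ f * q := Nat.mul_le_mul_left _ (by omega)
    refine caseB N q f (by omega) hf hN x _ _ ?_ rfl
    have : ∀ i, i < f - 1 → hat q (N - i) f = q + 1 + i - f := by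
      intro i hi
      unfold hat; rw [Nat.add_mul]; omega
    rw [← Finset.sum_subset (s₁ := Finset.Icc (f + 1 - (q + 1)) (f - 2)) (s₂ := Finset.range (f - 1))]
    · refine Finset.sum_congr rfl fun i hi => ?_
      rw [Finset.mem_Icc] at hi
      rw [this i (by omega), mul_comm]
    · intro i hi
      rw [Finset.mem_Icc] at hi
      rw [Finset.mem_range]; omega
    · intro i hi hi2
      rw [Finset.mem_range] at hi
      rw [Finset.mem_Icc] at hi2
      rw [this i hi, mul_eq_zero]; right; omega
  · rw [if_neg hc]
    have hfd : (N + 1) / (q + 1) = N / (q + 1) := by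
      have h1 := Nat.div_add_mod N (q + 1)
      have h2 := Nat.mod_lt N (by omega : 0 < q + 1)
      rw [Nat.div_eq_iff (by omega), mul_comm]
      omega
    have hr2 := Nat.mod_lt N (by omega : 0 < q + 1)
    have hN : N = N / (q + 1) * (q + 1) + N % (q + 1) := by
      rw [mul_comm]; exact (Nat.div_add_mod N (q + 1)).symm
    have hf : 1 ≤ N / (q + 1) := Nat.div_pos (by omega) (by omega)
    rw [hfd]
    simp only [Multiset.map_add, Multiset.sum_add, Multiset.map_replicate,
      Multiset.sum_replicate, smul_eq_mul, count_L N q _ x (by omega)]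
    generalize N / (q + 1) = f at *
    generalize N % (q + 1) = r at *
    have hNe : N = f * q + f + r := by rw [hN]; ring
    have hd : (f + 1) * (q + 1) - N = q + 1 - r := by
      have : (f + 1) * (q + 1) = f * q + f + q + 1 := by ring
      omega
    rw [hd, ← add_assoc, ← Finset.sum_range_succ
      (fun i => N.choose i * ((if x = i then 1 else 0) + hat q (N - i) x)),
      show f - 1 + 1 = f by omega]
    refine caseA N q f r (by omega) hf (by omega) hN x _ _ ?_ rfl
    have : ∀ i, i < f → hat q (N - i) f = q + 1 - r + i - (f + 1) := by
      intro i hi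
      unfold hat; rw [Nat.add_mul]; omega
    rw [← Finset.sum_subset (s₁ := Finset.Icc (f + 2 - (q + 1 - r)) (f - 1)) (s₂ := Finset.range f)]
    · refine Finset.sum_congr rfl fun i hi => ?_
      rw [Finset.mem_Icc] at hi
      rw [this i (by omega), mul_comm]
    · intro i hi
      rw [Finset.mem_Icc] at hi
      rw [Finset.mem_range]; omega
    · intro i hi hi2
      rw [Finset.mem_range] at hi
      rw [Finset.mem_Icc] at hi2
      rw [this i hi, mul_eq_zero]; right; omega
end

section
/- Let N and v be integers with 2 ≤ v ≤ N, let f = ⌊(N+1)/v⌋ and d = (f+1)v − N, and let LAK_{(1̄,1)}(N,v) denote the largest integer k for which there exists an N×k array on v symbols whose kv fibers are pairwise distinct and all nonempty. If d ≥ f+2 and the residue x ∈ {0,…,d−1} of Σ_{i=0}^{f} (f+1−i)·C(N,i) modulo d satisfies f+1 ≤ x ≤ d−1, then LAK_{(1̄,1)}(N,v) = Λ(N,v); otherwise LAK_{(1̄,1)}(N,v) = Λ(N,v) − 1. -/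
theorem rounding_aux {K J C : Type} [Fintype K] [Fintype J] [Fintype C] [DecidableEq K]
    [DecidableEq C] (x : K → J → ℚ) (hx : ∀ k j, 0 ≤ x k j) (h1 : ∀ k, ∑ j, x k j = 1)
    (cl : K → J → C) (L U : C → ℕ)
    (hL : ∀ c, (L c : ℚ) ≤ ∑ k, ∑ j, if cl k j = c then x k j else 0)
    (hU : ∀ c, (∑ k, ∑ j, if cl k j = c then x k j else 0) ≤ (U c : ℚ)) :
    ∃ φ : K → J, (∀ k, x k (φ k) ≠ 0) ∧
      ∀ c, L c ≤ (Finset.univ.filter (fun k => cl k (φ k) = c)).card ∧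
        (Finset.univ.filter (fun k => cl k (φ k) = c)).card ≤ U c := by
  classical
  set X : C → ℚ := fun c => ∑ k, ∑ j, if cl k j = c then x k j else 0 with hX
  have hLU : ∀ c, L c ≤ U c := fun c => by exact_mod_cast (hL c).trans (hU c)
  have hsum : ∀ A : Finset K, ∑ c, ∑ k ∈ A, ∑ j, (if cl k j = c then x k j else 0) = A.card := by
    intro A
    rw [Finset.sum_comm]
    have : ∀ k ∈ A, ∑ c, ∑ j, (if cl k j = c then x k j else 0) = 1 := by
      intro k _
      rw [Finset.sum_comm]
      simp [h1]
    rw [Finset.sum_congr rfl this]; simp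
  have hXK : ∑ c, X c = Fintype.card K := by
    have := hsum Finset.univ
    simpa [hX] using this
  have hKU : Fintype.card K ≤ ∑ c, U c := by
    have : (Fintype.card K : ℚ) ≤ ∑ c, (U c : ℚ) := by
      rw [← hXK]; exact Finset.sum_le_sum fun c _ => hU c
    exact_mod_cast this
  set M := (∑ c, U c) - Fintype.card K with hM
  let nb : K ⊕ Fin M → Finset (Σ c, Fin (U c)) := fun a => match a with
    | Sum.inl k => Finset.univ.filter (fun p => ∃ j, x k j ≠ 0 ∧ cl k j = p.1)
    | Sum.inr _ => Finset.univ.filter (fun p => L p.1 ≤ p.2.val)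
  have hall : ∀ s : Finset (K ⊕ Fin M), s.card ≤ (s.biUnion nb).card := by
    intro s
    set A := s.toLeft with hA
    set D := s.toRight with hD
    have hs : s.card = A.card + D.card := (Finset.card_toLeft_add_card_toRight).symm
    set CA : Finset C := Finset.univ.filter (fun c => ∃ k ∈ A, ∃ j, x k j ≠ 0 ∧ cl k j = c) with hCA
    have hAle : (A.card : ℚ) ≤ ∑ c ∈ CA, X c := by
      rw [← hsum A, ← Finset.sum_subset (Finset.subset_univ CA)]
      · refine Finset.sum_le_sum fun c _ => ?_
        refine Finset.sum_le_sum_of_subset_of_nonneg (Finset.subset_univ _) ?_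
        intro k _ _
        refine Finset.sum_nonneg fun j _ => ?_
        split_ifs
        · exact hx k j
        · exact le_rfl
      · intro c _ hc
        refine Finset.sum_eq_zero fun k hk => Finset.sum_eq_zero fun j _ => ?_
        split_ifs with h
        · by_contra h0
          exact hc (by simp only [hCA, Finset.mem_filter, Finset.mem_univ, true_and]; exact ⟨k, hk, j, h0, h⟩)
        · rfl
    by_cases hDe : D = ∅
    · have hsub : CA.sigma (fun c => (Finset.univ : Finset (Fin (U c)))) ⊆ s.biUnion nb := by
        rintro ⟨c, l⟩ hp
        simp only [Finset.mem_sigma, hCA, Finset.mem_filter, Finset.mem_univ, true_and, and_true] at hp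
        obtain ⟨k, hk, j, h0, h⟩ := hp
        rw [Finset.mem_biUnion]
        refine ⟨Sum.inl k, by simpa [hA] using hk, ?_⟩
        simp only [nb, Finset.mem_filter, Finset.mem_univ, true_and]
        exact ⟨j, h0, h⟩
      refine le_trans ?_ (Finset.card_le_card hsub)
      rw [Finset.card_sigma, hs, hDe]
      simp only [Finset.card_empty, add_zero, Finset.card_univ, Fintype.card_fin]
      have : (A.card : ℚ) ≤ ∑ c ∈ CA, (U c : ℚ) := hAle.trans (Finset.sum_le_sum fun c _ => hU c)
      exact_mod_cast this
    · obtain ⟨y, hy⟩ := Finset.nonempty_iff_ne_empty.mpr hDe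
      have hsub : (Finset.univ : Finset C).sigma (fun c => if c ∈ CA then (Finset.univ : Finset (Fin (U c))) else Finset.univ.filter (fun l => L c ≤ l.val)) ⊆ s.biUnion nb := by
        rintro ⟨c, l⟩ hp
        simp only [Finset.mem_sigma, Finset.mem_univ, true_and] at hp
        rw [Finset.mem_biUnion]
        by_cases hc : c ∈ CA
        · simp only [hCA, Finset.mem_filter, Finset.mem_univ, true_and] at hc
          obtain ⟨k, hk, j, h0, h⟩ := hc
          refine ⟨Sum.inl k, by simpa [hA] using hk, ?_⟩
          simp only [nb, Finset.mem_filter, Finset.mem_univ, true_and]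
          exact ⟨j, h0, h⟩
        · rw [if_neg hc] at hp
          refine ⟨Sum.inr y, by simpa [hD] using hy, ?_⟩
          simpa [nb] using hp
      refine le_trans ?_ (Finset.card_le_card hsub)
      rw [Finset.card_sigma, hs]
      have hcard : ∀ c, ((if c ∈ CA then (Finset.univ : Finset (Fin (U c))) else Finset.univ.filter (fun l => L c ≤ l.val)).card : ℚ) = if c ∈ CA then (U c : ℚ) else (U c : ℚ) - L c := by
        intro c
        split_ifs
        · simp
        · have e : (Finset.univ.filter (fun l : Fin (U c) => L c ≤ l.val)).card = U c - L c := by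
            have h2 := Finset.card_filter_add_card_filter_not (s := (Finset.univ : Finset (Fin (U c)))) (fun l => l.val < L c)
            have h3 : (Finset.univ.filter (fun l : Fin (U c) => l.val < L c)).card = L c := by
              rw [Fin.card_filter_val_lt]; exact min_eq_right (hLU c)
            simp only [not_lt, Finset.card_univ, Fintype.card_fin] at h2
            omega
          rw [e, Nat.cast_sub (hLU c)]
      have hDM : (D.card : ℚ) ≤ (∑ c, (U c : ℚ)) - ∑ c, X c := by
        have : D.card ≤ M := by simpa using Finset.card_le_univ D
        have h5 : (M : ℚ) = (∑ c, (U c : ℚ)) - Fintype.card K := by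
          rw [hM, Nat.cast_sub hKU]; push_cast; rfl
        rw [hXK, ← h5]; exact_mod_cast this
      have key : ((A.card + D.card : ℕ) : ℚ) ≤ ∑ c, if c ∈ CA then (U c : ℚ) else (U c : ℚ) - L c := by
        push_cast
        have e1 : ∑ c ∈ CA, X c = ∑ c, if c ∈ CA then X c else 0 := by
          rw [Finset.sum_ite_mem, Finset.univ_inter]
        rw [e1] at hAle
        refine (add_le_add hAle hDM).trans ?_
        rw [← Finset.sum_sub_distrib, ← Finset.sum_add_distrib]
        refine Finset.sum_le_sum fun c _ => ?_
        split_ifs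
        · linarith
        · have := hL c; simp only [hX]; linarith
      have : ((A.card + D.card : ℕ) : ℚ) ≤ ((∑ c, (if c ∈ CA then (Finset.univ : Finset (Fin (U c))) else Finset.univ.filter (fun l => L c ≤ l.val)).card : ℕ) : ℚ) := by
        rw [Nat.cast_sum, Finset.sum_congr rfl (fun c _ => hcard c)]; exact key
      exact_mod_cast this
  obtain ⟨F, hFi, hF⟩ := (Finset.all_card_le_biUnion_card_iff_exists_injective nb).mp hall
  have hFb : Function.Bijective F := by
    rw [Fintype.bijective_iff_injective_and_card]
    refine ⟨hFi, ?_⟩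
    simp only [Fintype.card_sum, Fintype.card_fin, Fintype.card_sigma]
    omega
  have hch : ∀ k, ∃ j, x k j ≠ 0 ∧ cl k j = (F (Sum.inl k)).1 := by
    intro k
    have := hF (Sum.inl k)
    simpa [nb] using this
  choose φ hφ0 hφ using hch
  refine ⟨φ, hφ0, fun c => ⟨?_, ?_⟩⟩
  · have : (Finset.univ.filter (fun l : Fin (U c) => l.val < L c)).card = L c := by
      rw [Fin.card_filter_val_lt]; exact min_eq_right (hLU c)
    rw [← this]
    rw [← Finset.card_map (Function.Embedding.sigmaMk (β := fun c => Fin (U c)) c),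
      ← Finset.card_image_of_injective (f := fun k => F (Sum.inl k)) _ (hFi.comp Sum.inl_injective)]
    refine Finset.card_le_card ?_
    intro p hp
    simp only [Finset.mem_map, Finset.mem_filter, Finset.mem_univ, true_and] at hp
    obtain ⟨l, hl, rfl⟩ := hp
    obtain ⟨a, ha⟩ := hFb.2 ⟨c, l⟩
    rcases a with k | y
    · simp only [Finset.mem_image, Finset.mem_filter, Finset.mem_univ, true_and]
      refine ⟨k, ?_, ha⟩
      rw [hφ, ha]
    · exfalso
      have h := hF (Sum.inr y)
      rw [ha] at h
      simp only [nb, Finset.mem_filter, Finset.mem_univ, true_and] at h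
      omega
  · have : (Finset.univ.map (Function.Embedding.sigmaMk (β := fun c => Fin (U c)) c)).card = U c := by simp
    rw [← this, ← Finset.card_image_of_injective (f := fun k => F (Sum.inl k)) _ (hFi.comp Sum.inl_injective)]
    refine Finset.card_le_card ?_
    intro p hp
    simp only [Finset.mem_image, Finset.mem_filter, Finset.mem_univ, true_and] at hp
    obtain ⟨k, hk, rfl⟩ := hp
    rw [hφ] at hk
    subst hk
    simp

def tset {N : ℕ} {K J : Type} [DecidableEq J] (A : Fin N → K → J) (t : ℕ) (k : K) (j : J) :
    Finset (Fin N) := Finset.univ.filter (fun r => r.val < t ∧ A r k = j)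

def BInv {N : ℕ} {K J : Type} [Fintype K] [Fintype J] [DecidableEq J]
    (s : K → J → Fin (N + 1)) (A : Fin N → K → J) (t : ℕ) : Prop :=
  (∀ k j, (tset A t k j).card ≤ (s k j).val) ∧
  ∀ c : Fin (N + 1) × Finset (Fin N),
    (Finset.univ.filter (fun p : K × J => (s p.1 p.2, tset A t p.1 p.2) = c)).card
      ≤ (N - t).choose (c.1.val - c.2.card)

theorem tset_sum {N : ℕ} {K J : Type} [Fintype J] [DecidableEq J]
    (A : Fin N → K → J) (t : ℕ) (ht : t ≤ N) (k : K) : ∑ j, (tset A t k j).card = t := by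
  have h : (Finset.univ.filter (fun r : Fin N => r.val < t)).card = t := by
    rw [Fin.card_filter_val_lt]; exact min_eq_right ht
  conv_rhs => rw [← h]
  rw [Finset.card_eq_sum_card_fiberwise (f := fun r => A r k) (t := Finset.univ) (by simp)]
  refine Finset.sum_congr rfl fun j _ => ?_
  rw [tset, Finset.filter_filter]

theorem tset_update {N : ℕ} {K J : Type} [DecidableEq J]
    (A : Fin N → K → J) (t : ℕ) (ht : t < N) (φ : K → J) (k : K) (j : J) :
    tset (Function.update A ⟨t, ht⟩ φ) (t + 1) k j =
      if φ k = j then insert ⟨t, ht⟩ (tset A t k j) else tset A t k j := by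
  ext r
  by_cases hr : r = ⟨t, ht⟩
  · subst hr
    split_ifs with h <;> simp [tset, h]
  · have : r.val ≠ t := fun h => hr (Fin.ext h)
    split_ifs with h <;> simp [tset, hr] <;> intro _ <;> omega

theorem baranyai_step_s18 {N : ℕ} {K J : Type} [Fintype K] [Fintype J] [DecidableEq K] [DecidableEq J]
    (s : K → J → Fin (N + 1)) (hs : ∀ k, ∑ j, (s k j).val = N) (A : Fin N → K → J) (t : ℕ)
    (ht : t < N) (h : BInv s A t) : ∃ A', BInv s A' (t + 1) := by
  classical
  obtain ⟨M, hM⟩ : ∃ M, N - t = M + 1 := ⟨N - t - 1, by omega⟩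
  have hM' : N - (t + 1) = M := by omega
  obtain ⟨h1, h2⟩ := h
  set T := tset A t with hT
  set cl : K → J → Fin (N + 1) × Finset (Fin N) := fun k j => (s k j, T k j) with hcl
  set n : Fin (N + 1) × Finset (Fin N) → ℕ := fun c =>
    (Finset.univ.filter (fun p : K × J => cl p.1 p.2 = c)).card with hn
  have hn2 : ∀ c, n c ≤ (M + 1).choose (c.1.val - c.2.card) := by
    intro c; rw [← hM]; exact h2 c
  have hMpos : (0 : ℚ) < (M : ℚ) + 1 := by positivity
  let x : K → J → ℚ := fun k j => (((s k j).val : ℚ) - (T k j).card) / ((M : ℚ) + 1)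
  have hXc : ∀ c, (∑ k, ∑ j, if cl k j = c then x k j else 0)
      = n c * ((c.1.val : ℚ) - c.2.card) / ((M : ℚ) + 1) := by
    intro c
    have : ∀ k j, (if cl k j = c then x k j else 0) =
        if cl k j = c then ((c.1.val : ℚ) - c.2.card) / ((M : ℚ) + 1) else 0 := by
      intro k j
      split_ifs with h
      · rw [← h]
      · rfl
    simp_rw [this]
    rw [← Fintype.sum_prod_type' (f := fun k j => if cl k j = c then ((c.1.val : ℚ) - c.2.card) / ((M : ℚ) + 1) else 0)]
    rw [← Finset.sum_filter, Finset.sum_const, nsmul_eq_mul]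
    ring
  have hnpos : ∀ c, n c ≠ 0 → c.2.card ≤ c.1.val := by
    intro c hc
    obtain ⟨p, hp⟩ := Finset.card_pos.mp (Nat.pos_of_ne_zero hc)
    simp only [Finset.mem_filter, Finset.mem_univ, true_and] at hp
    rw [← hp]; exact h1 _ _
  obtain ⟨φ, hφ0, hφ⟩ := rounding_aux x
    (fun k j => div_nonneg (sub_nonneg.mpr (by exact_mod_cast h1 k j)) hMpos.le)
    (by
      intro k
      rw [← Finset.sum_div, Finset.sum_sub_distrib, div_eq_one_iff_eq hMpos.ne']
      have e1 : ∑ j, ((s k j).val : ℚ) = N := by exact_mod_cast hs k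
      have e2 : ∑ j, ((T k j).card : ℚ) = t := by exact_mod_cast tset_sum A t ht.le k
      rw [e1, e2]
      have : N = t + (M + 1) := by omega
      rw [this]; push_cast; ring)
    cl (fun c => n c - M.choose (c.1.val - c.2.card))
    (fun c => if c.1.val - c.2.card = 0 then 0 else M.choose (c.1.val - c.2.card - 1))
    (by
      intro c
      rw [hXc]
      by_cases hc : n c = 0
      · simp [hc]
      have hle := hnpos c hc
      have hb := hn2 c
      obtain ⟨g, hg⟩ : ∃ g, c.1.val = c.2.card + g := ⟨c.1.val - c.2.card, by omega⟩
      have hg' : c.1.val - c.2.card = g := by omega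
      rw [hg'] at hb ⊢
      have hgM : g ≤ M + 1 := by
        by_contra hcon
        rw [Nat.choose_eq_zero_of_lt (by omega)] at hb
        omega
      have e : (c.1.val : ℚ) - c.2.card = g := by rw [hg]; push_cast; ring
      rw [e, le_div_iff₀ hMpos]
      rcases le_total (n c) (M.choose g) with h3 | h3
      · rw [Nat.sub_eq_zero_of_le h3]
        rw [Nat.cast_zero, zero_mul]; exact mul_nonneg (Nat.cast_nonneg _) (Nat.cast_nonneg _)
      · rw [Nat.cast_sub h3]
        have e3 := Nat.choose_mul_succ_eq M g
        have e4 : (M.choose g : ℚ) * (M + 1) = (M + 1).choose g * (M + 1 - g) := by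
          have := congrArg (Nat.cast (R := ℚ)) e3
          push_cast [Nat.cast_sub hgM] at this
          exact this
        have h5 : (n c : ℚ) ≤ (M + 1).choose g := by exact_mod_cast hb
        have h6 : (0 : ℚ) ≤ M + 1 - g := by
          have : (g : ℚ) ≤ M + 1 := by exact_mod_cast hgM
          linarith
        nlinarith [mul_le_mul_of_nonneg_right h5 h6])
    (by
      intro c
      rw [hXc]
      by_cases hc : n c = 0
      · rw [hc, Nat.cast_zero, zero_mul, zero_div]; exact Nat.cast_nonneg _
      have hle := hnpos c hc
      have hb := hn2 c
      obtain ⟨g, hg⟩ : ∃ g, c.1.val = c.2.card + g := ⟨c.1.val - c.2.card, by omega⟩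
      have hg' : c.1.val - c.2.card = g := by omega
      rw [hg'] at hb ⊢
      have e : (c.1.val : ℚ) - c.2.card = g := by rw [hg]; push_cast; ring
      rw [e, div_le_iff₀ hMpos]
      rcases g with _ | g
      · simp
      · simp only [Nat.add_eq_zero_iff, one_ne_zero, and_false, if_false, Nat.add_sub_cancel]
        have e3 := Nat.add_one_mul_choose_eq M g
        have h5 : n c * (g + 1) ≤ M.choose g * (M + 1) := by
          rw [mul_comm (M.choose g), e3]; exact Nat.mul_le_mul_right _ hb
        exact_mod_cast h5)
  have hlt : ∀ k, (T k (φ k)).card < (s k (φ k)).val := by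
    intro k
    refine lt_of_le_of_ne (h1 _ _) fun h => hφ0 k ?_
    simp [x, h]
  have htT : ∀ k j, (⟨t, ht⟩ : Fin N) ∉ T k j := by
    intro k j; simp [hT, tset]
  refine ⟨Function.update A ⟨t, ht⟩ φ, ?_, ?_⟩
  · intro k j
    rw [tset_update]
    split_ifs with h
    · subst h
      rw [Finset.card_insert_of_notMem (htT _ _)]
      exact hlt k
    · exact h1 k j
  · rintro ⟨i, S⟩
    rw [hM']
    simp only [tset_update]
    -- selected pairs
    have hsel : ∀ c, (Finset.univ.filter (fun p : K × J => φ p.1 = p.2 ∧ cl p.1 p.2 = c)).card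
        = (Finset.univ.filter (fun k => cl k (φ k) = c)).card := by
      intro c
      symm
      refine Finset.card_bij (fun k _ => (k, φ k)) ?_ ?_ ?_
      · intro k hk; simpa using hk
      · intro a _ b _ hab; exact (Prod.ext_iff.mp hab).1
      · rintro ⟨k, j⟩ hp
        simp only [Finset.mem_filter, Finset.mem_univ, true_and] at hp
        obtain ⟨rfl, hp⟩ := hp
        exact ⟨k, by simpa using hp, rfl⟩
    by_cases hS : (⟨t, ht⟩ : Fin N) ∈ S
    · have hcS : (S.erase ⟨t, ht⟩).card + 1 = S.card := Finset.card_erase_add_one hS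
      have hb := (hφ (i, S.erase ⟨t, ht⟩)).2
      rw [← hsel] at hb
      refine (Finset.card_le_card ?_).trans (hb.trans ?_)
      · rintro ⟨k, j⟩ hp
        simp only [Finset.mem_filter, Finset.mem_univ, true_and, Prod.mk.injEq, hcl] at hp ⊢
        obtain ⟨hp1, hp2⟩ := hp
        split_ifs at hp2 with h
        · refine ⟨h, hp1, ?_⟩
          rw [← hp2, Finset.erase_insert (htT _ _)]
        · exact absurd (hp2 ▸ hS) (htT _ _)
      · simp only
        split_ifs with h
        · exact Nat.zero_le _
        · refine le_of_eq ?_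
          congr 1; omega
    · have hb := (hφ (i, S)).1
      rw [← hsel] at hb
      have hsplit := Finset.card_filter_add_card_filter_not
        (s := Finset.univ.filter (fun p : K × J => cl p.1 p.2 = (i, S))) (fun p => φ p.1 = p.2)
      rw [Finset.filter_filter, Finset.filter_filter] at hsplit
      have e1 : (Finset.univ.filter (fun p : K × J => cl p.1 p.2 = (i, S) ∧ φ p.1 = p.2)).card =
          (Finset.univ.filter (fun p : K × J => φ p.1 = p.2 ∧ cl p.1 p.2 = (i, S))).card := by
        congr 1; ext p; simp [and_comm]
      rw [e1] at hsplit
      have hle : (Finset.univ.filter (fun p : K × J => (s p.1 p.2,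
          if φ p.1 = p.2 then insert ⟨t, ht⟩ (tset A t p.1 p.2) else tset A t p.1 p.2) = (i, S))).card
          ≤ (Finset.univ.filter (fun p : K × J => cl p.1 p.2 = (i, S) ∧ ¬ φ p.1 = p.2)).card := by
        refine Finset.card_le_card ?_
        rintro ⟨k, j⟩ hp
        simp only [Finset.mem_filter, Finset.mem_univ, true_and, Prod.mk.injEq, hcl] at hp ⊢
        obtain ⟨hp1, hp2⟩ := hp
        split_ifs at hp2 with h
        · exact absurd (by rw [← hp2]; exact Finset.mem_insert_self _ _) hS
        · exact ⟨⟨hp1, hp2⟩, h⟩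
      refine hle.trans ?_
      have : n (i, S) = (Finset.univ.filter (fun p : K × J => cl p.1 p.2 = (i, S))).card := rfl
      simp only at hb ⊢
      omega

theorem baranyai {N : ℕ} {K J : Type} [Fintype K] [Fintype J] [DecidableEq K] [DecidableEq J]
    (s : K → J → ℕ) (hs : ∀ k, ∑ j, s k j = N) (hv : Nonempty J)
    (hc : ∀ i, (Finset.univ.filter (fun p : K × J => s p.1 p.2 = i)).card ≤ N.choose i) :
    ∃ A : Fin N → K → J,
      (Function.Injective fun p : K × J => {r : Fin N | A r p.1 = p.2}) ∧
      ∀ p : K × J, {r : Fin N | A r p.1 = p.2}.ncard = s p.1 p.2 := by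
  classical
  have hle : ∀ k j, s k j < N + 1 := by
    intro k j
    have := Finset.single_le_sum (f := s k) (fun _ _ => Nat.zero_le _) (Finset.mem_univ j)
    rw [hs] at this; omega
  let s' : K → J → Fin (N + 1) := fun k j => ⟨s k j, hle k j⟩
  have hind : ∀ t ≤ N, ∃ A : Fin N → K → J, BInv s' A t := by
    intro t
    induction t with
    | zero =>
      intro _
      refine ⟨fun _ _ => hv.some, ?_, ?_⟩
      · intro k j; simp [tset]
      · rintro ⟨i, S⟩
        by_cases hS : S = ∅
        · subst hS
          refine le_trans (Finset.card_le_card ?_) (hc i.val)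
          intro p hp
          simp only [Finset.mem_filter, Finset.mem_univ, true_and, Prod.mk.injEq] at hp ⊢
          rw [← hp.1]
        · refine le_trans (le_of_eq ?_) (Nat.zero_le _)
          rw [Finset.card_eq_zero, Finset.filter_eq_empty_iff]
          intro p _ hp
          simp only [Prod.mk.injEq] at hp
          exact hS (by rw [← hp.2]; simp [tset])
    | succ t ih =>
      intro ht
      obtain ⟨A, hA⟩ := ih (by omega)
      exact baranyai_step_s18 s' hs A t (by omega) hA
  obtain ⟨A, hA1, hA2⟩ := hind N le_rfl
  have hcard : ∀ k j, (tset A N k j).card = s k j := by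
    intro k
    have h := tset_sum A N le_rfl k
    replace h := h.trans (hs k).symm
    have := (Finset.sum_eq_sum_iff_of_le (fun j _ => hA1 k j)).mp h
    intro j; exact this j (Finset.mem_univ _)
  have hset : ∀ k j, {r : Fin N | A r k = j} = (tset A N k j : Set (Fin N)) := by
    intro k j; ext r; simp [tset]
  refine ⟨A, ?_, ?_⟩
  · intro p q hpq
    simp only [hset] at hpq
    have hpq := Finset.coe_injective hpq
    have hb := hA2 (s' p.1 p.2, tset A N p.1 p.2)
    rw [Nat.sub_self] at hb
    have h1 : (0 : ℕ).choose ((s' p.1 p.2).val - (tset A N p.1 p.2).card) ≤ 1 := by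
      rw [hcard]; simp [s']
    have hb := hb.trans h1
    rw [Finset.card_le_one] at hb
    refine hb p (by simp) q ?_
    simp only [Finset.mem_filter, Finset.mem_univ, true_and, Prod.mk.injEq]
    refine ⟨?_, hpq.symm⟩
    apply Fin.ext
    show s q.1 q.2 = s p.1 p.2
    rw [← hcard, ← hcard, hpq]
  · intro p
    rw [hset, Set.ncard_coe_finset, hcard]

theorem exists_enum {α : Type} (v : ℕ) (c : Multiset α) (hc : c.card = v) :
    ∃ s : Fin v → α, (Finset.univ : Finset (Fin v)).val.map s = c := by
  subst hc
  induction c using Quotient.inductionOn with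
  | h l =>
    refine ⟨fun j => l.get j, ?_⟩
    rw [Fin.univ_val_map]
    exact congrArg _ (List.ofFn_get l)

theorem array_of_family (N v : ℕ) (hv : 0 < v) (F : Multiset (Multiset ℕ))
    (hcard : ∀ c ∈ F, c.card = v) (hsum : ∀ c ∈ F, c.sum = N) (h0 : ∀ c ∈ F, 0 ∉ c)
    (hcount : ∀ i, i ≠ 0 → F.sum.count i ≤ N.choose i) :
    ∃ A : Fin N → Fin F.card → Fin v,
      (Function.Injective fun p : Fin F.card × Fin v => {r : Fin N | A r p.1 = p.2}) ∧
      ∀ p : Fin F.card × Fin v, {r : Fin N | A r p.1 = p.2}.Nonempty := by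
  obtain ⟨g, hg⟩ := exists_enum F.card F rfl
  have hmem : ∀ k, g k ∈ F := by
    intro k
    have h := Multiset.mem_map_of_mem g (Finset.mem_val.mpr (Finset.mem_univ k))
    rwa [hg] at h
  choose s hs using fun k => exists_enum v (g k) (hcard _ (hmem k))
  have hmem2 : ∀ k j, s k j ∈ g k := by
    intro k j
    rw [← hs k]
    exact Multiset.mem_map_of_mem (s k) (Finset.mem_univ j)
  have hne : ∀ k j, s k j ≠ 0 := fun k j h => h0 _ (hmem k) (h ▸ hmem2 k j)
  have hcnt : ∀ i, (Finset.univ.filter (fun p : Fin F.card × Fin v => s p.1 p.2 = i)).card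
      = F.sum.count i := by
    intro i
    have e1 : F.sum = ∑ k, g k := by
      conv_lhs => rw [← hg]
      rfl
    rw [e1, Multiset.count_sum', Finset.card_filter, Fintype.sum_prod_type]
    refine Finset.sum_congr rfl fun k _ => ?_
    rw [← hs k, Multiset.count_map, ← Finset.card_filter]
    simp only [eq_comm (a := i)]
    rfl
  obtain ⟨A, hA1, hA2⟩ := baranyai (N := N) s
    (by
      intro k
      have := hsum _ (hmem k)
      rw [← hs k] at this
      exact this)
    ⟨⟨0, hv⟩⟩
    (by
      intro i
      by_cases hi : i = 0
      · subst hi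
        rw [Finset.filter_false_of_mem (fun p _ => hne _ _)]
        simp
      · rw [hcnt]; exact hcount i hi)
  refine ⟨A, hA1, fun p => ?_⟩
  apply Set.nonempty_of_ncard_ne_zero
  rw [hA2]
  exact hne _ _

def Wt (N m d : ℕ) : ℕ := ∑ i ∈ Finset.Ico 1 m, min d (m - i) * N.choose i

theorem upper (N v m d k : ℕ) (hN : N + d = m * v)
    (A : Fin N → Fin k → Fin v)
    (hA1 : Function.Injective fun p : Fin k × Fin v => {r : Fin N | A r p.1 = p.2})
    (hA2 : ∀ p : Fin k × Fin v, {r : Fin N | A r p.1 = p.2}.Nonempty) :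
    d * k ≤ Wt N m d := by
  classical
  have hset : ∀ p : Fin k × Fin v, {r : Fin N | A r p.1 = p.2} = (tset A N p.1 p.2 : Set (Fin N)) := by
    intro p; ext r; simp [tset]
  simp only [hset] at hA1 hA2
  have hinj : Function.Injective fun p : Fin k × Fin v => tset A N p.1 p.2 := by
    intro p q h
    apply hA1
    simp only at h ⊢
    rw [h]
  have hcol : ∀ c : Fin k, d ≤ ∑ j, min d (m - (tset A N c j).card) := by
    intro c
    by_cases h : ∃ j, d ≤ m - (tset A N c j).card
    · obtain ⟨j, hj⟩ := h
      have := Finset.single_le_sum (f := fun j => min d (m - (tset A N c j).card))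
        (fun _ _ => Nat.zero_le _) (Finset.mem_univ j)
      simp only [min_eq_left hj] at this
      exact this
    · push Not at h
      have h1 : ∑ j, min d (m - (tset A N c j).card) = ∑ j, (m - (tset A N c j).card) :=
        Finset.sum_congr rfl fun j _ => min_eq_right (h j).le
      have h2 : ∑ j : Fin v, m ≤ ∑ j, ((m - (tset A N c j).card) + (tset A N c j).card) :=
        Finset.sum_le_sum fun j _ => by omega
      rw [Finset.sum_add_distrib, tset_sum A N le_rfl c] at h2
      simp only [Finset.sum_const, Finset.card_univ, Fintype.card_fin, smul_eq_mul] at h2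
      rw [h1]
      have : v * m = m * v := mul_comm _ _
      omega
  let w : ℕ → ℕ := fun i => if i = 0 then 0 else min d (m - i)
  have hw : ∀ p : Fin k × Fin v, min d (m - (tset A N p.1 p.2).card) = w (tset A N p.1 p.2).card := by
    intro p
    have : (tset A N p.1 p.2).card ≠ 0 := by
      have := hA2 p
      rw [Finset.coe_nonempty] at this
      exact (Finset.card_pos.mpr this).ne'
    simp [w, this]
  calc d * k = ∑ c : Fin k, d := by simp [mul_comm]
    _ ≤ ∑ c : Fin k, ∑ j, min d (m - (tset A N c j).card) := Finset.sum_le_sum fun c _ => hcol c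
    _ = ∑ p : Fin k × Fin v, w (tset A N p.1 p.2).card := by
        rw [← Fintype.sum_prod_type' (f := fun c j => min d (m - (tset A N c j).card))]
        exact Finset.sum_congr rfl fun p _ => hw p
    _ = ∑ S ∈ Finset.univ.image (fun p : Fin k × Fin v => tset A N p.1 p.2), w S.card := by
        rw [Finset.sum_image (fun a _ b _ h => hinj h)]
    _ ≤ ∑ S ∈ (Finset.univ : Finset (Fin N)).powerset, w S.card :=
        Finset.sum_le_sum_of_subset (by intro S _; simp)
    _ = ∑ i ∈ Finset.range (N + 1), N.choose i * w i := by
        rw [Finset.sum_powerset_apply_card]; simp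
    _ ≤ ∑ i ∈ Finset.range (N + 1) ∪ Finset.Ico 1 m, N.choose i * w i :=
        Finset.sum_le_sum_of_subset Finset.subset_union_left
    _ = ∑ i ∈ Finset.Ico 1 m, N.choose i * w i := by
        symm
        refine Finset.sum_subset Finset.subset_union_right ?_
        intro i _ hi
        simp only [Finset.mem_Ico, not_and, not_lt] at hi
        by_cases h0 : i = 0
        · simp [w, h0]
        · have : m - i = 0 := by have := hi (by omega); omega
          simp [w, this]
    _ = Wt N m d := by
        unfold Wt
        refine Finset.sum_congr rfl fun i hi => ?_
        have : i ≠ 0 := by simp at hi; omega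
        simp [w, this, mul_comm]

theorem lam_eq (N v f d x : ℕ) (hf : f = (N + 1) / v) (hd : d = (f + 1) * v - N) (hd2 : 2 ≤ d)
    (hx : x = (∑ i ∈ Finset.range (f + 1), (f + 1 - i) * N.choose i) % d) :
    (if f + 2 ≤ d ∧ f + 1 ≤ x then Lam N v else Lam N v - 1) = Wt N (f + 1) d / d := by
  have hL : Lam N v = (∑ i ∈ Finset.Icc (f + 2 - d) f, (f + 1 - i) * N.choose i) / d
    + ∑ i ∈ Finset.range (f + 2 - d), N.choose i := by
    unfold Lam
    simp only [← hf, ← hd]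
  have hIcc : ∀ a, Finset.Icc a f = Finset.Ico a (f + 1) := by
    intro a; ext i; simp only [Finset.mem_Icc, Finset.mem_Ico]; omega
  rw [hIcc] at hL
  by_cases hdf : d ≤ f + 1
  · rw [if_neg (by omega), hL]
    have e1 : Wt N (f + 1) d = d * ∑ i ∈ Finset.Ico 1 (f + 2 - d), N.choose i
        + ∑ i ∈ Finset.Ico (f + 2 - d) (f + 1), (f + 1 - i) * N.choose i := by
      unfold Wt
      rw [← Finset.sum_Ico_consecutive _ (show 1 ≤ f + 2 - d by omega) (show f + 2 - d ≤ f + 1 by omega),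
        Finset.mul_sum]
      congr 1
      · refine Finset.sum_congr rfl fun i hi => ?_
        rw [Finset.mem_Ico] at hi
        rw [min_eq_left (by omega)]
      · refine Finset.sum_congr rfl fun i hi => ?_
        rw [Finset.mem_Ico] at hi
        rw [min_eq_right (by omega)]
    have e2 : ∑ i ∈ Finset.range (f + 2 - d), N.choose i
        = 1 + ∑ i ∈ Finset.Ico 1 (f + 2 - d), N.choose i := by
      rw [Finset.range_eq_Ico, Finset.sum_eq_sum_Ico_succ_bot (by omega)]
      simp
    rw [e1, e2, Nat.mul_add_div (by omega)]
    have h : ∀ a b : ℕ, a + (1 + b) - 1 = b + a := by intro a b; omega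
    exact h _ _
  · have e0 : f + 2 - d = 0 := by omega
    rw [e0] at hL
    simp only [Finset.range_zero, Finset.sum_empty, add_zero] at hL
    rw [← Finset.range_eq_Ico] at hL
    have e1 : ∑ i ∈ Finset.range (f + 1), (f + 1 - i) * N.choose i = (f + 1) + Wt N (f + 1) d := by
      rw [Finset.range_eq_Ico, Finset.sum_eq_sum_Ico_succ_bot (by omega)]
      simp only [Nat.sub_zero, Nat.choose_zero_right, mul_one, zero_add]
      congr 1
      unfold Wt
      refine Finset.sum_congr rfl fun i hi => ?_
      rw [Finset.mem_Ico] at hi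
      rw [min_eq_right (by omega)]
    rw [e1] at hL hx
    generalize Wt N (f + 1) d = W at *
    have h1 := Nat.div_add_mod (f + 1 + W) d
    rw [← hx, ← hL] at h1
    have h2 : x < d := hx ▸ Nat.mod_lt _ (by omega)
    generalize Lam N v = q at *
    split_ifs with h
    · have : W = d * q + (x - (f + 1)) := by omega
      rw [this, Nat.mul_add_div (by omega), Nat.div_eq_of_lt (by omega), add_zero]
    · rcases q with _ | q
      · omega
      · have h3 : d * (q + 1) = d * q + d := by ring
        have : W = d * q + (d + x - (f + 1)) := by omega
        rw [this, Nat.mul_add_div (by omega), Nat.div_eq_of_lt (by omega)]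
        omega

def colm (v f d i : ℕ) : Multiset ℕ :=
  if i + d ≤ f + 1 then {i} + Multiset.replicate (v - 2) (f + 1) + {2 * (f + 1) - d - i}
  else {i} + Multiset.replicate (d - (f + 1 - i)) f
    + Multiset.replicate (v - 1 - (d - (f + 1 - i))) (f + 1)

def zc (v f d i : ℕ) : ℕ :=
  if i + d < f + 1 then v - 2 else v - 1 - (d - min d (f + 1 - i))

theorem colm_card (v f d i : ℕ) (hv : 2 ≤ v) (hd : d ≤ v + 1) (hi : i < f) :
    (colm v f d i).card = v := by
  unfold colm
  split_ifs <;> simp <;> omega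

theorem colm_sum (N v f d i : ℕ) (hN : N + d = (f + 1) * v) (hv : 2 ≤ v) (hd : d ≤ v + 1)
    (hi : i < f) : (colm v f d i).sum = N := by
  unfold colm
  obtain ⟨w, rfl⟩ : ∃ w, v = w + 2 := ⟨v - 2, by omega⟩
  split_ifs with h
  · simp only [Multiset.sum_add, Multiset.sum_singleton, Multiset.sum_replicate, smul_eq_mul]
    obtain ⟨a, ha⟩ : ∃ a, f + 1 = i + d + a := ⟨f + 1 - (i + d), by omega⟩
    have e : 2 * (f + 1) - d - i = (f + 1) + a := by omega
    rw [e, Nat.add_sub_cancel]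
    nlinarith
  · simp only [Multiset.sum_add, Multiset.sum_singleton, Multiset.sum_replicate, smul_eq_mul]
    obtain ⟨a, ha⟩ : ∃ a, d - (f + 1 - i) = a := ⟨_, rfl⟩
    obtain ⟨b, hb⟩ : ∃ b, w + 2 - 1 - (d - (f + 1 - i)) = b := ⟨_, rfl⟩
    have h1 : w + 1 = a + b := by omega
    have h2 : d + i = a + (f + 1) := by omega
    rw [hb, ha]
    have : w = a + b - 1 := by omega
    have h3 : (f + 1) * (w + 2) = (f + 1) * (a + b + 1) := by congr 1; omega
    rw [h3] at hN
    nlinarith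

theorem colm_zero (v f d i : ℕ) (hi : i < f) (hi1 : 1 ≤ i) : 0 ∉ colm v f d i := by
  unfold colm
  split_ifs <;> simp [Multiset.mem_replicate] <;> omega

theorem colm_count_lt (v f d i x : ℕ) (hi : i < f) (hx : x < f) :
    (colm v f d i).count x = if x = i then 1 else 0 := by
  unfold colm
  split_ifs with h1 h2 h2 <;>
    simp only [Multiset.count_add, Multiset.count_replicate, Multiset.count_singleton] <;>
    split_ifs <;> omega

theorem colm_count_f (v f d i : ℕ) (hi : i < f) :
    (colm v f d i).count f = d - min d (f + 1 - i) := by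
  unfold colm
  split_ifs with h1 <;>
    simp only [Multiset.count_add, Multiset.count_replicate, Multiset.count_singleton] <;>
    split_ifs <;> omega

theorem colm_count_m (v f d i : ℕ) (hv : 2 ≤ v) (hi : i < f) :
    (colm v f d i).count (f + 1) = zc v f d i := by
  unfold colm zc
  split_ifs with h1 <;>
    simp only [Multiset.count_add, Multiset.count_replicate, Multiset.count_singleton] <;>
    split_ifs <;> omega

theorem colm_count_gt (v f d i x : ℕ) (hi : i < f) (hx : f + 1 < x) :
    (colm v f d i).count x ≤ if i = 2 * (f + 1) - d - x then 1 else 0 := by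
  unfold colm
  split_ifs with h1 <;>
    simp only [Multiset.count_add, Multiset.count_replicate, Multiset.count_singleton] <;>
    split_ifs <;> omega

theorem choose_le_of (N i x : ℕ) (h1 : i ≤ x) (h2 : x + i ≤ N) : N.choose i ≤ N.choose x := by
  have e := Nat.choose_mul (n := N) (k := x) (s := i) h1
  have h3 : x.choose i ≤ (N - i).choose (x - i) := by
    rw [← Nat.choose_symm h1]
    exact Nat.choose_le_choose _ (by omega)
  have hpos : 0 < (N - i).choose (x - i) := Nat.choose_pos (by omega)
  refine Nat.le_of_mul_le_mul_right ?_ hpos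
  rw [← e]
  exact Nat.mul_le_mul_left _ h3

theorem family_ok (N v f d : ℕ) (hN : N + d = (f + 1) * v) (hv : 2 ≤ v) (hd2 : 2 ≤ d)
    (hd : d ≤ v + 1) (hf : 1 ≤ f) (μ : ℕ → ℕ) (p δ : ℕ)
    (hμ : ∀ i, 1 ≤ i → i < f → μ i + (if i = f - 1 then 2 * δ else 0) ≤ N.choose i)
    (hp : p = 0 ∨ d ≤ v) (hδ : δ = 0 ∨ (d = v + 1 ∧ 4 ≤ d ∧ 2 ≤ f))
    (hones : ∑ i ∈ Finset.Ico 1 f, μ i * (d - min d (f + 1 - i)) + p * d + δ * (d - 4) ≤ N.choose f)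
    (hzeros : ∑ i ∈ Finset.Ico 1 f, μ i * zc v f d i + p * (v - d) + δ ≤ N.choose (f + 1)) :
    ∃ F : Multiset (Multiset ℕ), F.card = ∑ i ∈ Finset.Ico 1 f, μ i + p + δ ∧
      (∀ c ∈ F, c.card = v) ∧ (∀ c ∈ F, c.sum = N) ∧ (∀ c ∈ F, 0 ∉ c) ∧
      (∀ i, i ≠ 0 → F.sum.count i ≤ N.choose i) := by
  set P : Multiset ℕ := Multiset.replicate d f + Multiset.replicate (v - d) (f + 1) with hP
  set D : Multiset ℕ := Multiset.replicate 2 (f - 1) + Multiset.replicate (d - 4) f + {f + 1} with hD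
  let F : Multiset (Multiset ℕ) := ∑ i ∈ Finset.Ico 1 f, Multiset.replicate (μ i) (colm v f d i)
    + Multiset.replicate p P + Multiset.replicate δ D
  have hmem : ∀ c ∈ F, (∃ i, 1 ≤ i ∧ i < f ∧ c = colm v f d i) ∨ (d ≤ v ∧ c = P) ∨
      ((d = v + 1 ∧ 4 ≤ d ∧ 2 ≤ f) ∧ c = D) := by
    intro c hc
    simp only [F, Multiset.mem_add, Multiset.mem_sum, Multiset.mem_replicate, Finset.mem_Ico] at hc
    rcases hc with (⟨i, hi, _, rfl⟩ | ⟨h0, rfl⟩) | ⟨h0, rfl⟩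
    · exact Or.inl ⟨i, hi.1, hi.2, rfl⟩
    · exact Or.inr (Or.inl ⟨hp.resolve_left h0, rfl⟩)
    · exact Or.inr (Or.inr ⟨hδ.resolve_left h0, rfl⟩)
  refine ⟨F, ?_, ?_, ?_, ?_, ?_⟩
  · simp [F]
  · intro c hc
    rcases hmem c hc with ⟨i, h1, h2, rfl⟩ | ⟨h1, rfl⟩ | ⟨h1, rfl⟩
    · exact colm_card v f d i hv hd h2
    · simp [hP]; omega
    · simp [hD]; omega
  · intro c hc
    rcases hmem c hc with ⟨i, h1, h2, rfl⟩ | ⟨h1, rfl⟩ | ⟨h1, rfl⟩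
    · exact colm_sum N v f d i hN hv hd h2
    · obtain ⟨w, rfl⟩ : ∃ w, v = d + w := ⟨v - d, by omega⟩
      simp only [hP, Multiset.sum_add, Multiset.sum_replicate, smul_eq_mul, Nat.add_sub_cancel_left]
      nlinarith
    · obtain ⟨hdv, h4, h2⟩ := h1
      obtain ⟨w, rfl⟩ : ∃ w, v = w + 3 := ⟨v - 3, by omega⟩
      obtain ⟨g, rfl⟩ : ∃ g, f = g + 1 := ⟨f - 1, by omega⟩
      subst hdv
      simp only [hD, Multiset.sum_add, Multiset.sum_replicate, smul_eq_mul, Nat.add_sub_cancel,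
        Multiset.sum_singleton]
      have : w + 3 + 1 - 4 = w := by omega
      rw [this]
      nlinarith
  · intro c hc
    rcases hmem c hc with ⟨i, h1, h2, rfl⟩ | ⟨h1, rfl⟩ | ⟨h1, rfl⟩
    · exact colm_zero v f d i h2 h1
    · simp [hP, Multiset.mem_replicate]; omega
    · simp [hD, Multiset.mem_replicate]; omega
  · intro x hx
    have hcnt : F.sum.count x = ∑ i ∈ Finset.Ico 1 f, μ i * (colm v f d i).count x
        + p * P.count x + δ * D.count x := by
      have e : F.sum = ∑ i ∈ Finset.Ico 1 f, μ i • (colm v f d i) + p • P + δ • D := by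
        have e1 : (∑ i ∈ Finset.Ico 1 f, Multiset.replicate (μ i) (colm v f d i)).sum =
            ∑ i ∈ Finset.Ico 1 f, (Multiset.replicate (μ i) (colm v f d i)).sum :=
          map_sum (Multiset.sumAddMonoidHom : Multiset (Multiset ℕ) →+ Multiset ℕ) _ _
        simp only [F, Multiset.sum_add, e1, Multiset.sum_replicate]
      rw [e]
      simp only [Multiset.count_add, Multiset.count_sum', Multiset.count_nsmul]
    rw [hcnt]
    rcases lt_trichotomy x f with h | h | h
    · have h1 : ∑ i ∈ Finset.Ico 1 f, μ i * (colm v f d i).count x = μ x := by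
        rw [Finset.sum_congr rfl (g := fun i => if x = i then μ i else 0)]
        · rw [Finset.sum_ite_eq, if_pos (by rw [Finset.mem_Ico]; omega)]
        · intro i hi
          rw [Finset.mem_Ico] at hi
          rw [colm_count_lt v f d i x hi.2 h]; simp
      have h2 : P.count x = 0 := by
        simp only [hP, Multiset.count_add, Multiset.count_replicate]
        split_ifs <;> omega
      have h3 : D.count x = if x = f - 1 then 2 else 0 := by
        simp only [hD, Multiset.count_add, Multiset.count_replicate, Multiset.count_singleton]
        split_ifs <;> omega
      have := hμ x (by omega) h
      rw [h1, h2, h3]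
      split_ifs at this ⊢ <;> omega
    · subst h
      have h1 : ∑ i ∈ Finset.Ico 1 x, μ i * (colm v x d i).count x =
          ∑ i ∈ Finset.Ico 1 x, μ i * (d - min d (x + 1 - i)) := by
        refine Finset.sum_congr rfl fun i hi => ?_
        rw [Finset.mem_Ico] at hi
        rw [colm_count_f v x d i hi.2]
      have h2 : P.count x = d := by
        simp only [hP, Multiset.count_add, Multiset.count_replicate]
        split_ifs <;> omega
      have h3 : D.count x = d - 4 := by
        simp only [hD, Multiset.count_add, Multiset.count_replicate, Multiset.count_singleton]
        split_ifs <;> omega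
      rw [h1, h2, h3]; exact hones
    · rcases Nat.lt_or_ge (f + 1) x with h' | h'
      · have h1 : ∑ i ∈ Finset.Ico 1 f, μ i * (colm v f d i).count x ≤
            ∑ i ∈ Finset.Ico 1 f, if 2 * (f + 1) - d - x = i then μ i else 0 := by
          refine Finset.sum_le_sum fun i hi => ?_
          rw [Finset.mem_Ico] at hi
          have := colm_count_gt v f d i x hi.2 h'
          by_cases hh : i = 2 * (f + 1) - d - x
          · rw [if_pos hh.symm]
            rw [if_pos hh] at this
            exact (Nat.mul_le_mul_left _ this).trans (by simp)
          · rw [if_neg (Ne.symm hh)]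
            rw [if_neg hh] at this
            rw [Nat.le_zero.mp this]; simp
        rw [Finset.sum_ite_eq] at h1
        have h2 : P.count x = 0 := by
          simp only [hP, Multiset.count_add, Multiset.count_replicate]
          split_ifs <;> omega
        have h3 : D.count x = 0 := by
          simp only [hD, Multiset.count_add, Multiset.count_replicate, Multiset.count_singleton]
          split_ifs <;> omega
        rw [h2, h3, mul_zero, mul_zero, add_zero, add_zero]
        refine h1.trans ?_
        split_ifs with hh
        · rw [Finset.mem_Ico] at hh
          have h4 : (f + 1) * 2 ≤ (f + 1) * v := Nat.mul_le_mul_left _ hv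
          exact le_trans (le_trans (Nat.le_add_right _ _) (hμ _ hh.1 hh.2))
            (choose_le_of _ _ _ (by omega) (by omega))
        · exact Nat.zero_le _
      · have : x = f + 1 := by omega
        subst this
        have h1 : ∑ i ∈ Finset.Ico 1 f, μ i * (colm v f d i).count (f + 1) =
            ∑ i ∈ Finset.Ico 1 f, μ i * zc v f d i := by
          refine Finset.sum_congr rfl fun i hi => ?_
          rw [Finset.mem_Ico] at hi
          rw [colm_count_m v f d i hv hi.2]
        have h2 : P.count (f + 1) = v - d := by
          simp only [hP, Multiset.count_add, Multiset.count_replicate]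
          split_ifs <;> omega
        have h3 : D.count (f + 1) = 1 := by
          simp only [hD, Multiset.count_add, Multiset.count_replicate, Multiset.count_singleton]
          split_ifs <;> omega
        rw [h1, h2, h3, mul_one]; exact hzeros

theorem ratio (N v f j : ℕ) (hv : 2 ≤ v) (hNf : f * v ≤ N + 1) (hj : j + 1 ≤ f) :
    (v - 1) * N.choose j ≤ N.choose (j + 1) := by
  have e := Nat.choose_succ_right_eq N j
  have h1 : (j + 1) * v ≤ f * v := Nat.mul_le_mul_right _ hj
  obtain ⟨q, rfl⟩ : ∃ q, v = q + 1 := ⟨v - 1, by omega⟩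
  have h2 : q * (j + 1) ≤ N - j := by
    have : (j + 1) * (q + 1) = q * (j + 1) + j + 1 := by ring
    omega
  refine Nat.le_of_mul_le_mul_right (c := j + 1) ?_ (by omega)
  rw [e, Nat.add_sub_cancel]
  calc q * N.choose j * (j + 1) = N.choose j * (q * (j + 1)) := by ring
    _ ≤ _ := Nat.mul_le_mul_left _ h2

theorem geom (N v f j : ℕ) (hv : 2 ≤ v) (hNf : f * v ≤ N + 1) (hj : j ≤ f) :
    (v - 2) * ∑ i ∈ Finset.Ico 1 j, N.choose i ≤ N.choose j := by
  induction j with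
  | zero => simp
  | succ j ih =>
    rcases Nat.eq_zero_or_pos j with h0 | h0
    · subst h0; simp
    · rw [Finset.sum_Ico_succ_top h0, mul_add]
      have h1 := ih (by omega)
      have h2 := ratio N v f j hv hNf hj
      obtain ⟨q, rfl⟩ : ∃ q, v = q + 2 := ⟨v - 2, by omega⟩
      have : q + 2 - 1 = q + 1 := by omega
      rw [this] at h2
      rw [Nat.add_sub_cancel] at h1 ⊢
      nlinarith

theorem Wt_split (N f d : ℕ) (hf : 1 ≤ f) (hd : 1 ≤ d) :
    Wt N (f + 1) d = ∑ i ∈ Finset.Ico 1 f, min d (f + 1 - i) * N.choose i + N.choose f := by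
  unfold Wt
  rw [Finset.sum_Ico_succ_top hf]
  have : min d (f + 1 - f) = 1 := by omega
  rw [this, one_mul]

theorem split_min (N f d a : ℕ) :
    ∑ i ∈ Finset.Ico 1 a, N.choose i * (d - min d (f + 1 - i)) +
      ∑ i ∈ Finset.Ico 1 a, min d (f + 1 - i) * N.choose i = d * ∑ i ∈ Finset.Ico 1 a, N.choose i := by
  rw [← Finset.sum_add_distrib, Finset.mul_sum]
  refine Finset.sum_congr rfl fun i _ => ?_
  rw [mul_comm _ (N.choose i), ← mul_add, mul_comm]
  congr 1; omega

theorem poly1 (m v d N : ℕ) (hm : 3 ≤ m) (hd : 3 ≤ d) (hv : d ≤ v) (hN : N + d = m * v) :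
    m * (m - 1) * (2 * v + d) ≤ (N + 2 - m) * (d - 1) * N := by
  obtain ⟨a, rfl⟩ : ∃ a, m = a + 3 := ⟨m - 3, by omega⟩
  obtain ⟨b, rfl⟩ : ∃ b, d = b + 3 := ⟨d - 3, by omega⟩
  obtain ⟨c, rfl⟩ : ∃ c, v = b + 3 + c := ⟨v - (b + 3), by omega⟩
  have hN' : N = (a + 3) * (b + 3 + c) - (b + 3) := by omega
  have e1 : (a + 3) * (b + 3 + c) - (b + 3) = (a + 2) * (b + 3 + c) + c := by
    have : (a + 3) * (b + 3 + c) = (a + 2) * (b + 3 + c) + c + (b + 3) := by ring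
    omega
  rw [e1] at hN'
  have e2 : N + 2 - (a + 3) = (a + 2) * (b + 2 + c) + c + 1 := by
    have : (a + 2) * (b + 3 + c) = (a + 2) * (b + 2 + c) + (a + 2) := by ring
    omega
  have e3 : a + 3 - 1 = a + 2 := by omega
  have e4 : b + 3 - 1 = b + 2 := by omega
  rw [e2, e3, e4, hN']
  zify
  have : (0:ℤ) ≤ a := by positivity
  have : (0:ℤ) ≤ b := by positivity
  have : (0:ℤ) ≤ c := by positivity
  rw [← sub_nonneg]
  ring_nf
  positivity

theorem arith2 (g u a0 a1 a2 R B p : ℕ) (hgeo : u * R ≤ a2)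
    (c0 : a0 * (g + 2) + a1 = a1 * ((g + 2) * (u + 1)))
    (c1 : a1 * (g + 1) = a2 * ((g + 2) * (u + 1)))
    (hB : B ≤ u * R + a2 * (u + 1)) (hp : p * 2 * u ≤ a1 * u) : B + p * u ≤ a0 := by
  have hR2 : 2 * (u * R) ≤ (u + 1) * u * a2 := by
    rcases Nat.eq_zero_or_pos u with h0 | h0
    · subst h0; simp
    · have h1 : 2 ≤ (u + 1) * u := by nlinarith
      exact Nat.mul_le_mul h1 hgeo
  have hgoal : a1 * u + (u + 1) * (u + 2) * a2 ≤ 2 * a0 := by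
    refine Nat.le_of_mul_le_mul_right (c := g + 2) ?_ (by omega)
    have h2 : (u + 1) * (u + 2) * a2 * (g + 2) = (u + 2) * (a1 * (g + 1)) := by
      rw [c1]; ring
    have h3 : 0 ≤ a1 * u := Nat.zero_le _
    rw [add_mul, h2]
    linarith
  linarith

theorem arith3 (u e a0 a1 a2 B p : ℕ)
    (hgoal : a1 * u + (2 * u + 3 * (e + 2)) * a2 ≤ (e + 2) * a0)
    (hB : B ≤ 2 * a2 + a2 * (u + 1)) (hp : p * (e + 2) * u + a2 * e * u ≤ a1 * u) :
    B + p * u ≤ a0 := by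
  refine le_of_mul_le_mul_left (a := e + 2) ?_ (by omega)
  have := Nat.mul_le_mul_left (e + 2) hB
  linarith

theorem exists_family1 (N v f d : ℕ) (hN : N + d = (f + 1) * v) (hv : 2 ≤ v) (hd2 : 2 ≤ d)
    (hd : d ≤ v) (hf : 1 ≤ f) :
    ∃ F : Multiset (Multiset ℕ), F.card = Wt N (f + 1) d / d ∧
      (∀ c ∈ F, c.card = v) ∧ (∀ c ∈ F, c.sum = N) ∧ (∀ c ∈ F, 0 ∉ c) ∧
      (∀ i, i ≠ 0 → F.sum.count i ≤ N.choose i) := by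
  have hNf : f * v ≤ N + 1 := by
    have : (f + 1) * v = f * v + v := by ring
    omega
  have hW := Wt_split N f d hf (by omega)
  have hA := split_min N f d f
  set W := Wt N (f + 1) d with hWdef
  set k := W / d with hk
  set A1 := ∑ i ∈ Finset.Ico 1 f, N.choose i * (d - min d (f + 1 - i)) with hA1
  set A2 := ∑ i ∈ Finset.Ico 1 f, min d (f + 1 - i) * N.choose i with hA2
  set Q := ∑ i ∈ Finset.Ico 1 f, N.choose i with hQ
  have hkd : d * k ≤ W := Nat.mul_div_le W d
  have hA1le : A1 ≤ N.choose f := by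
    refine le_trans ?_ (geom N v f f hv hNf le_rfl)
    rw [hA1, Finset.mul_sum]
    refine Finset.sum_le_sum fun i hi => ?_
    rw [Finset.mem_Ico] at hi
    rw [mul_comm]
    exact Nat.mul_le_mul_right _ (by omega)
  have hQk : Q ≤ k := by
    rw [hk, Nat.le_div_iff_mul_le (by omega), mul_comm]
    omega
  obtain ⟨p, hp⟩ : ∃ p, k = Q + p := ⟨k - Q, by omega⟩
  have hpd : p * d + A1 ≤ N.choose f := by
    rw [hp, mul_add, mul_comm d p] at hkd
    omega
  have key : ∑ i ∈ Finset.Ico 1 f, N.choose i * zc v f d i + p * (v - d) ≤ N.choose (f + 1) := by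
    have c0 : N.choose (f + 1) * (f + 1) = N.choose f * (N - f) := Nat.choose_succ_right_eq N f
    obtain ⟨u, hu⟩ : ∃ u, v = d + u := ⟨v - d, by omega⟩
    have hvd : v - d = u := by omega
    rw [hvd]
    have hpu : (p * d + A1) * u ≤ N.choose f * u := Nat.mul_le_mul_right _ hpd
    have hNfe : N - f + f = N := by
      have : f * 2 ≤ f * v := Nat.mul_le_mul_left _ hv
      omega
    rcases Nat.lt_or_ge f 2 with hf2 | hf2
    · have : f = 1 := by omega
      subst this
      simp only [Finset.Ico_self, Finset.sum_empty, zero_add]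
      have h3 : u * 2 ≤ d * (N - 1) := by
        have : u ≤ N - 1 := by omega
        rw [mul_comm]
        exact Nat.mul_le_mul hd2 this
      have hpd' : p * d ≤ N.choose 1 := by omega
      refine Nat.le_of_mul_le_mul_right (c := d * (1 + 1)) ?_ (by omega)
      calc p * u * (d * (1 + 1)) = (p * d) * (u * 2) := by ring
        _ ≤ N.choose 1 * (d * (N - 1)) := Nat.mul_le_mul hpd' h3
        _ = d * (N.choose 1 * (N - 1)) := by ring
        _ = d * (N.choose (1 + 1) * (1 + 1)) := by rw [c0]
        _ = _ := by ring
    · obtain ⟨g, rfl⟩ : ∃ g, f = g + 1 := ⟨f - 1, by omega⟩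
      have hg1 : 1 ≤ g := by omega
      have c1 : N.choose (g + 1) * (g + 1) = N.choose g * (N - g) := Nat.choose_succ_right_eq N g
      set R := ∑ i ∈ Finset.Ico 1 g, N.choose i with hR
      have hgeo : (v - 2) * R ≤ N.choose g := geom N v (g + 1) g hv hNf (by omega)
      have hA1ge : N.choose g * (d - 2) ≤ A1 := by
        rw [hA1, Finset.sum_Ico_succ_top hg1]
        have : min d (g + 1 + 1 - g) = 2 := by omega
        rw [this]; omega
      have hB : ∀ b, (∀ i, 1 ≤ i → i < g → zc v (g + 1) d i ≤ b) →
          ∑ i ∈ Finset.Ico 1 (g + 1), N.choose i * zc v (g + 1) d i ≤ b * R + N.choose g * (u + 1) := by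
        intro b hb
        rw [Finset.sum_Ico_succ_top hg1, hR, Finset.mul_sum]
        have : zc v (g + 1) d g = u + 1 := by unfold zc; split_ifs <;> omega
        rw [this]
        refine Nat.add_le_add_right (Finset.sum_le_sum fun i hi => ?_) _
        rw [Finset.mem_Ico] at hi
        rw [mul_comm]
        exact Nat.mul_le_mul_right _ (hb i hi.1 hi.2)
      set B := ∑ i ∈ Finset.Ico 1 (g + 1), N.choose i * zc v (g + 1) d i with hBdef
      generalize N.choose (g + 1 + 1) = a0 at *
      generalize N.choose (g + 1) = a1 at *
      generalize N.choose g = a2 at *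
      have hpu2 : p * d * u + a2 * (d - 2) * u ≤ a1 * u := by
        have := Nat.mul_le_mul_right u hA1ge
        rw [add_mul] at hpu
        omega
      rcases Nat.lt_or_ge d 3 with hd3 | hd3
      · have : d = 2 := by omega
        subst this
        have hB2 := hB (v - 2) (by
          intro i h1 h2; unfold zc; rw [if_pos (by omega)])
        have hv2 : v - 2 = u := by omega
        rw [hv2] at hB2 hgeo
        -- N + 2 = (g+2)(u+2)
        have hN1 : N - (g + 1) = (g + 2) * (u + 1) - 1 := by
          have : (g + 1 + 1) * v = (g + 2) * (u + 1) + (g + 2) := by rw [hu]; ring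
          omega
        have hN2 : N - g = (g + 2) * (u + 1) := by
          have : (g + 1 + 1) * v = (g + 2) * (u + 1) + (g + 2) := by rw [hu]; ring
          omega
        have c0' : a0 * (g + 2) + a1 = a1 * ((g + 2) * (u + 1)) := by
          have h5 : 1 ≤ (g + 2) * (u + 1) := Nat.one_le_iff_ne_zero.mpr (by positivity)
          have h6 : (N - (g + 1)) + 1 = (g + 2) * (u + 1) := by omega
          rw [← h6, Nat.mul_succ a1, ← c0]
        rw [hN2] at c1
        have hpu3 : p * 2 * u ≤ a1 * u := by simpa using hpu2
        exact arith2 g u a0 a1 a2 R B p hgeo c0' c1 hB2 hpu3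
      · have hB2 := hB (v - 1) (by
          intro i h1 h2; unfold zc; split_ifs <;> omega)
        have hvR : (v - 1) * R ≤ 2 * a2 := by
          have h5 : (v - 1) * R ≤ (2 * (v - 2)) * R := Nat.mul_le_mul_right _ (by omega)
          have h6 : (2 * (v - 2)) * R = 2 * ((v - 2) * R) := by ring
          omega
        have hpoly := poly1 (g + 2) v d N (by omega) hd3 hd (by rw [hN])
        have hs1 : N + 2 - (g + 2) = N - g := by omega
        have hs2 : g + 2 - 1 = g + 1 := by omega
        rw [hs1, hs2] at hpoly
        obtain ⟨e, rfl⟩ : ∃ e, d = e + 2 := ⟨d - 2, by omega⟩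
        rw [Nat.add_sub_cancel] at hpu2
        have hs3 : e + 2 - 1 = e + 1 := by omega
        rw [hs3] at hpoly
        -- a1*(e+1)*N ≥ (g+2)*(2v+d)*a2
        have h7 : (g + 2) * (2 * v + (e + 2)) * a2 ≤ a1 * (e + 1) * N := by
          refine Nat.le_of_mul_le_mul_right (c := g + 1) ?_ (by omega)
          calc (g + 2) * (2 * v + (e + 2)) * a2 * (g + 1)
              = a2 * ((g + 2) * (g + 1) * (2 * v + (e + 2))) := by ring
            _ ≤ a2 * ((N - g) * (e + 1) * N) := Nat.mul_le_mul_left _ hpoly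
            _ = (a2 * (N - g)) * ((e + 1) * N) := by ring
            _ = (a1 * (g + 1)) * ((e + 1) * N) := by rw [c1]
            _ = _ := by ring
        have h8 : a0 * (e + 2) * (g + 2) = a1 * (e + 1) * N + a1 * u * (g + 2) := by
          have h9 : (e + 2) * (N - (g + 1)) = (e + 1) * N + u * (g + 2) := by
            have h10 : N + (e + 2) = (g + 2) * (e + 2 + u) := by rw [hN, hu]
            have h11 : N - (g + 1) + (g + 1) = N := by omega
            zify at h10 h11 ⊢
            have h12 : ((N - (g + 1) : ℕ) : ℤ) = N - (g + 1) := by linarith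
            rw [h12]
            linear_combination h10
          calc a0 * (e + 2) * (g + 2) = (a0 * (g + 1 + 1)) * (e + 2) := by ring
            _ = a1 * ((e + 2) * (N - (g + 1))) := by rw [c0]; ring
            _ = _ := by rw [h9]; ring
        have hgoal : a1 * u + (2 * v + (e + 2)) * a2 ≤ (e + 2) * a0 := by
          refine Nat.le_of_mul_le_mul_right (c := g + 2) ?_ (by omega)
          linarith
        have hB3 : B ≤ 2 * a2 + a2 * (u + 1) := by omega
        have h13 : 2 * v + (e + 2) = 2 * u + 3 * (e + 2) := by omega
        rw [h13] at hgoal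
        exact arith3 u e a0 a1 a2 B p hgoal hB3 hpu2
  obtain ⟨F, hF1, hF2⟩ := family_ok N v f d hN hv hd2 (by omega) hf (fun i => N.choose i) p 0
    (by intro i _ _; simp) (Or.inr hd) (Or.inl rfl) (by simpa [add_comm] using hpd) (by simpa using key)
  exact ⟨F, by rw [hF1, hp]; simp [hQ], hF2⟩

theorem exists_family2 (N v f d : ℕ) (hN : N + d = (f + 1) * v) (hv : 2 ≤ v)
    (hd : d = v + 1) (hf : 2 ≤ f) :
    ∃ F : Multiset (Multiset ℕ), F.card = Wt N (f + 1) d / d ∧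
      (∀ c ∈ F, c.card = v) ∧ (∀ c ∈ F, c.sum = N) ∧ (∀ c ∈ F, 0 ∉ c) ∧
      (∀ i, i ≠ 0 → F.sum.count i ≤ N.choose i) := by
  have hNf : f * v = N + 1 := by
    have : (f + 1) * v = f * v + v := by ring
    omega
  have hW := Wt_split N f d (by omega) (by omega)
  obtain ⟨g, rfl⟩ : ∃ g, f = g + 1 := ⟨f - 1, by omega⟩
  have hg1 : 1 ≤ g := by omega
  have hA := split_min N (g + 1) d g
  have hgeo := geom N v (g + 1) g hv hNf.le (by omega)
  rw [Finset.sum_Ico_succ_top hg1] at hW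
  have hmin : min d (g + 1 + 1 - g) = 2 := by omega
  rw [hmin] at hW
  have c1 : N.choose (g + 1) = (v - 1) * N.choose g := by
    have c1 : N.choose (g + 1) * (g + 1) = N.choose g * (N - g) := Nat.choose_succ_right_eq N g
    obtain ⟨q, rfl⟩ : ∃ q, v = q + 1 := ⟨v - 1, by omega⟩
    have h5 : N - g = q * (g + 1) := by
      have : (g + 1) * (q + 1) = q * (g + 1) + g + 1 := by ring
      omega
    rw [h5] at c1
    refine Nat.eq_of_mul_eq_mul_right (m := g + 1) (by omega) ?_
    rw [c1, Nat.add_sub_cancel]; ring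
  set W := Wt N (g + 1 + 1) d with hWdef
  set k := W / d with hk
  set A1 := ∑ i ∈ Finset.Ico 1 g, N.choose i * (d - min d (g + 1 + 1 - i)) with hA1
  set A2 := ∑ i ∈ Finset.Ico 1 g, min d (g + 1 + 1 - i) * N.choose i with hA2
  set R := ∑ i ∈ Finset.Ico 1 g, N.choose i with hR
  set Rt := ∑ i ∈ Finset.Ico 1 g, (if i + d ≤ g + 2 then N.choose i else 0) with hRt
  set Rm := ∑ i ∈ Finset.Ico 1 g, (if i + d ≤ g + 2 then 0 else N.choose i) with hRm
  have hRR : Rt + Rm = R := by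
    rw [hRt, hRm, hR, ← Finset.sum_add_distrib]
    refine Finset.sum_congr rfl fun i _ => ?_
    split_ifs <;> omega
  have hW2 : W = d * N.choose g + A2 := by
    rw [hW, c1]
    obtain ⟨q, rfl⟩ : ∃ q, v = q + 1 := ⟨v - 1, by omega⟩
    rw [hd, Nat.add_sub_cancel]; ring
  have hA2t : d * Rt ≤ A2 := by
    rw [hRt, hA2, Finset.mul_sum]
    refine Finset.sum_le_sum fun i hi => ?_
    split_ifs with h
    · exact Nat.mul_le_mul_right _ (by omega)
    · simp
  have hkd : d * k ≤ W := Nat.mul_div_le W d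
  have hkQ : k ≤ R + N.choose g := by
    refine Nat.div_le_of_le_mul ?_
    rw [mul_add]; omega
  have hkge : N.choose g + Rt ≤ k := by
    rw [hk, Nat.le_div_iff_mul_le (by omega), mul_comm, mul_add]; omega
  obtain ⟨δ, hδ⟩ : ∃ δ, R + N.choose g = k + δ := ⟨R + N.choose g - k, by omega⟩
  have hδm : δ ≤ Rm := by omega
  have hRm2 : v = 2 → Rm = 0 := by
    intro h2
    rw [hRm]
    refine Finset.sum_eq_zero fun i hi => ?_
    rw [Finset.mem_Ico] at hi
    rw [if_pos (by omega)]
  have h2δ : 2 * δ ≤ N.choose g := by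
    rcases Nat.lt_or_ge v 3 with h3 | h3
    · have := hRm2 (by omega); omega
    rcases Nat.lt_or_ge v 4 with h4 | h4
    · have h5 : Rm ≤ N.choose (g - 1) := by
        calc Rm ≤ ∑ i ∈ Finset.Ico 1 g, (if g - 1 = i then N.choose i else 0) := by
              refine Finset.sum_le_sum fun i hi => ?_
              rw [Finset.mem_Ico] at hi
              split_ifs <;> omega
          _ ≤ _ := by
              rw [Finset.sum_ite_eq]; split_ifs <;> omega
      have h6 := ratio N v (g + 1) (g - 1) hv hNf.le (by omega)
      have h7 : g - 1 + 1 = g := by omega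
      have h8 : v - 1 = 2 := by omega
      rw [h7, h8] at h6
      omega
    · have : 2 * R ≤ (v - 2) * R := Nat.mul_le_mul_right _ (by omega)
      omega
  have hδ' : δ = 0 ∨ (d = v + 1 ∧ 4 ≤ d ∧ 2 ≤ g + 1) := by
    rcases Nat.lt_or_ge v 3 with h3 | h3
    · have := hRm2 (by omega); omega
    · right; omega
  set μ : ℕ → ℕ := fun i => if i = g then N.choose g - 2 * δ else N.choose i with hμ
  have hμs : ∀ h : ℕ → ℕ, ∑ i ∈ Finset.Ico 1 (g + 1), μ i * h i =
      ∑ i ∈ Finset.Ico 1 g, N.choose i * h i + (N.choose g - 2 * δ) * h g := by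
    intro h
    rw [Finset.sum_Ico_succ_top hg1]
    congr 1
    · refine Finset.sum_congr rfl fun i hi => ?_
      rw [Finset.mem_Ico] at hi
      simp only [hμ]
      rw [if_neg (by omega)]
    · simp [hμ]
  have hδd : A1 ≤ δ * d := by
    have h1 : d * (R + N.choose g) = d * (k + δ) := by rw [hδ]
    rw [mul_add, mul_add, mul_comm d δ] at h1
    omega
  have hones : ∑ i ∈ Finset.Ico 1 (g + 1), μ i * (d - min d (g + 1 + 1 - i)) + 0 * d + δ * (d - 4)
      ≤ N.choose (g + 1) := by
    rw [hμs, hmin, c1, zero_mul, add_zero]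
    have e1 : d - 2 = v - 1 := by omega
    rw [e1]
    have e2 : (N.choose g - 2 * δ) * (v - 1) + 2 * δ * (v - 1) = (v - 1) * N.choose g := by
      rw [← add_mul, Nat.sub_add_cancel h2δ, mul_comm]
    have e3 : δ * d + δ * (d - 4) = 2 * δ * (v - 1) := by
      rcases hδ' with h | h
      · rw [h]; simp
      · have : d + (d - 4) = 2 * (v - 1) := by omega
        rw [← mul_add, this]; ring
    omega
  have hzeros : ∑ i ∈ Finset.Ico 1 (g + 1), μ i * zc v (g + 1) d i + 0 * (v - d) + δ
      ≤ N.choose (g + 1 + 1) := by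
    rw [hμs, zero_mul, add_zero]
    have e1 : zc v (g + 1) d g = 0 := by unfold zc; split_ifs <;> omega
    rw [e1, mul_zero, add_zero]
    rcases Nat.lt_or_ge v 3 with h3 | h3
    · have h0 : δ = 0 := by have := hRm2 (by omega); omega
      rw [h0, add_zero]
      calc ∑ i ∈ Finset.Ico 1 g, N.choose i * zc v (g + 1) d i
          ≤ ∑ i ∈ Finset.Ico 1 g, (if g - 1 = i then N.choose i else 0) := by
            refine Finset.sum_le_sum fun i hi => ?_
            rw [Finset.mem_Ico] at hi
            split_ifs with h
            · have : zc v (g + 1) d i ≤ 1 := by unfold zc; split_ifs <;> omega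
              exact (Nat.mul_le_mul_left _ this).trans (by simp)
            · have : zc v (g + 1) d i = 0 := by unfold zc; split_ifs <;> omega
              simp [this]
        _ ≤ N.choose (g - 1) := by
            rw [Finset.sum_ite_eq]; split_ifs <;> omega
        _ ≤ _ := by
            have : v = 2 := by omega
            subst this
            exact choose_le_of _ _ _ (by omega) (by omega)
    · have h4 : ∑ i ∈ Finset.Ico 1 g, N.choose i * zc v (g + 1) d i + Rm ≤ (v - 1) * R := by
        rw [hRm, hR, ← Finset.sum_add_distrib, Finset.mul_sum]
        refine Finset.sum_le_sum fun i hi => ?_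
        rw [Finset.mem_Ico] at hi
        split_ifs with h
        · have : zc v (g + 1) d i ≤ v - 1 := by unfold zc; split_ifs <;> omega
          rw [add_zero, mul_comm]
          exact Nat.mul_le_mul_right _ this
        · have : zc v (g + 1) d i + 1 ≤ v - 1 := by unfold zc; split_ifs <;> omega
          rw [← Nat.mul_succ, mul_comm]
          exact Nat.mul_le_mul_right _ this
      have h5 : (v - 1) * R ≤ 2 * N.choose g := by
        have h5 : (v - 1) * R ≤ (2 * (v - 2)) * R := Nat.mul_le_mul_right _ (by omega)
        have h6 : (2 * (v - 2)) * R = 2 * ((v - 2) * R) := by ring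
        omega
      have h6 : 2 * N.choose g ≤ N.choose (g + 1) := by
        rw [c1]; exact Nat.mul_le_mul_right _ (by omega)
      have h7 : N.choose (g + 1) ≤ N.choose (g + 1 + 1) := by
        have : (g + 1) * 3 ≤ (g + 1) * v := Nat.mul_le_mul_left _ h3
        exact choose_le_of _ _ _ (by omega) (by omega)
      omega
  obtain ⟨F, hF1, hF2⟩ := family_ok N v (g + 1) d hN hv (by omega) (by omega) (by omega) μ 0 δ
    (by
      intro i h1 h2
      simp only [hμ, Nat.add_sub_cancel]
      split_ifs with h
      · rw [h]; omega
      · omega) (Or.inl rfl) hδ' hones hzeros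
  refine ⟨F, ?_, hF2⟩
  rw [hF1]
  have := hμs (fun _ => 1)
  simp only [mul_one] at this
  rw [this]
  omega

theorem stmt18 (N v : ℕ) (hv : 2 ≤ v) (hvN : v ≤ N) :
    ∀ f d x : ℕ,
      f = (N + 1) / v →
      d = (f + 1) * v - N →
      x = (∑ i ∈ Finset.range (f + 1), (f + 1 - i) * N.choose i) % d →
      IsGreatest {k : ℕ | ∃ A : Fin N → Fin k → Fin v,
          (Function.Injective fun p : Fin k × Fin v => {r : Fin N | A r p.1 = p.2}) ∧
          ∀ p : Fin k × Fin v, {r : Fin N | A r p.1 = p.2}.Nonempty}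
        (if f + 2 ≤ d ∧ f + 1 ≤ x then Lam N v else Lam N v - 1) := by
  intro f d x hf hd hx
  have h1 : f * v ≤ N + 1 := hf ▸ Nat.div_mul_le_self (N + 1) v
  have h2 : N + 1 < (f + 1) * v := by
    rw [hf]
    exact Nat.lt_mul_of_div_lt (Nat.lt_succ_self _) (by omega)
  have h3 : (f + 1) * v = f * v + v := by ring
  have hf1 : 1 ≤ f := by
    rw [hf, Nat.le_div_iff_mul_le (by omega)]; omega
  have hd2 : 2 ≤ d := by omega
  have hdv : d ≤ v + 1 := by omega
  have hN : N + d = (f + 1) * v := by omega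
  rw [lam_eq N v f d x hf hd hd2 hx]
  constructor
  · have hF : ∃ F : Multiset (Multiset ℕ), F.card = Wt N (f + 1) d / d ∧
      (∀ c ∈ F, c.card = v) ∧ (∀ c ∈ F, c.sum = N) ∧ (∀ c ∈ F, 0 ∉ c) ∧
      (∀ i, i ≠ 0 → F.sum.count i ≤ N.choose i) := by
      rcases Nat.lt_or_ge v d with h | h
      · refine exists_family2 N v f d hN hv (by omega) ?_
        by_contra hcon
        have hf' : f = 1 := by omega
        rw [hf'] at h3 hN
        omega
      · exact exists_family1 N v f d hN hv hd2 h hf1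
    obtain ⟨F, hF1, hF2, hF3, hF4, hF5⟩ := hF
    rw [← hF1]
    exact array_of_family N v (by omega) F hF2 hF3 hF4 hF5
  · rintro k ⟨A, hA1, hA2⟩
    rw [Nat.le_div_iff_mul_le (by omega), mul_comm]
    exact upper N v (f + 1) d k hN A hA1 hA2
end
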